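/- Let ρ, σ : ℝ³ × ℝ → ℝ and F : ℝ³ × ℝ → ℝ³ be C², let e₁, e₂ ∈ C²(ℝ), and set S_Γ(v,σ) = e₁'(|D_Γ(v)|²) D_Γ(v) + e₂'(|div_Γ v|²)(div_Γ v) P_Γ − σ P_Γ. Assume that at every point of Γ_T := {(x,t) : x ∈ Γ(t), 0 < t < T} the continuity equation D_t ρ + (div_Γ v) ρ = 0 and the momentum equation ρ D_t v = div_Γ S_Γ(v,σ) + ρ F hold, and that S_Γ(v,σ)(x,t) ν(x,t) = 0 for H¹-a.e. x ∈ ∂Γ(t) for every t ∈ (0,T). Then the laws of conservation of momentum and of angular momentum hold: for all 0 < t₁ < t₂ < T, ∫_{Γ(t₂)} ρ v dH² = ∫_{Γ(t₁)} ρ v dH² + ∫_{t₁}^{t₂} ∫_{Γ(τ)} ρ F dH² dτ, and ∫_{Γ(t₂)} x × (ρ v) dH² = ∫_{Γ(t₁)} x × (ρ v) dH² + ∫_{t₁}^{t₂} ∫_{Γ(τ)} x × (ρ F) dH² dτ. -/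

import Mathlib

noncomputable section
open MeasureTheory

/-- ℝ² with the Euclidean structure. -/
abbrev E2 : Type := EuclideanSpace ℝ (Fin 2)
/-- ℝ³ with the Euclidean structure. -/
abbrev E3 : Type := EuclideanSpace ℝ (Fin 3)

/-- The cross product on ℝ³. -/
def cross3 (a b : E3) : E3 :=
  (EuclideanSpace.equiv (Fin 3) ℝ).symm
    ![a 1 * b 2 - a 2 * b 1, a 2 * b 0 - a 0 * b 2, a 0 * b 1 - a 1 * b 0]

/-- The dot product on ℝ³. -/
def dot3 (a b : E3) : ℝ := ∑ i, a i * b i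

/-- The tangent vector `g_α = ∂x̂/∂X_α` of the parametrization `x̂` at `(X, t)`. -/
def gVec (xh : E2 × ℝ → E3) (α : Fin 2) (X : E2) (t : ℝ) : E3 :=
  fderiv ℝ (fun Y : E2 => xh (Y, t)) X (EuclideanSpace.single α 1)

/-- The Riemannian metric `g_{αβ} = g_α · g_β`. -/
def gMet (xh : E2 × ℝ → E3) (α β : Fin 2) (X : E2) (t : ℝ) : ℝ :=
  dot3 (gVec xh α X t) (gVec xh β X t)

/-- The Gram determinant `G = g₁₁ g₂₂ − g₁₂ g₂₁`. -/
def Gdet (xh : E2 × ℝ → E3) (X : E2) (t : ℝ) : ℝ :=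
  gMet xh 0 0 X t * gMet xh 1 1 X t - gMet xh 0 1 X t * gMet xh 1 0 X t

/-- The inverse metric `(g^{αβ}) = (g_{αβ})⁻¹`. -/
def gInv (xh : E2 × ℝ → E3) (X : E2) (t : ℝ) : Matrix (Fin 2) (Fin 2) ℝ :=
  (Matrix.of fun α β => gMet xh α β X t)⁻¹

/-- The raised tangent vector `g^α = Σ_β g^{αβ} g_β`. -/
def gVecUp (xh : E2 × ℝ → E3) (α : Fin 2) (X : E2) (t : ℝ) : E3 :=
  ∑ β, gInv xh X t α β • gVec xh β X t

/-- The unit normal `n̂ = (g₁ × g₂)/|g₁ × g₂|` of the parametrized surface. -/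
def nHat (xh : E2 × ℝ → E3) (X : E2) (t : ℝ) : E3 :=
  ‖cross3 (gVec xh 0 X t) (gVec xh 1 X t)‖⁻¹ • cross3 (gVec xh 0 X t) (gVec xh 1 X t)

/-- Spatial partial derivative `∂f/∂x_j` at `(x, t)`. -/
def pdx (j : Fin 3) (f : E3 × ℝ → ℝ) (x : E3) (t : ℝ) : ℝ :=
  fderiv ℝ (fun y : E3 => f (y, t)) x (EuclideanSpace.single j 1)

/-- Time partial derivative `∂f/∂t` at `(x, t)`. -/
def pdt (f : E3 × ℝ → ℝ) (x : E3) (t : ℝ) : ℝ := deriv (fun s => f (x, s)) t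

/-- Tangential derivative `∂_j^Γ f = Σ_i (δ_{ij} − N_i N_j) ∂f/∂x_i`
with normal extension `N`. -/
def tder (N : E3 × ℝ → E3) (j : Fin 3) (f : E3 × ℝ → ℝ) (x : E3) (t : ℝ) : ℝ :=
  ∑ i, ((if i = j then (1 : ℝ) else 0) - N (x, t) i * N (x, t) j) * pdx i f x t

/-- Surface gradient `grad_Γ f = (∂_1^Γ f, ∂_2^Γ f, ∂_3^Γ f)`. -/
def sgrad (N : E3 × ℝ → E3) (f : E3 × ℝ → ℝ) (x : E3) (t : ℝ) : E3 :=
  (EuclideanSpace.equiv (Fin 3) ℝ).symm fun j => tder N j f x t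

/-- Surface divergence `div_Γ φ = Σ_j ∂_j^Γ φ_j`. -/
def sdiv (N : E3 × ℝ → E3) (φ : E3 × ℝ → E3) (x : E3) (t : ℝ) : ℝ :=
  ∑ j, tder N j (fun p => φ p j) x t

/-- Row-wise surface divergence of a matrix field: `(div_Γ M)_i = Σ_j ∂_j^Γ M_{ij}`. -/
def sdivM (N : E3 × ℝ → E3) (M : E3 × ℝ → Matrix (Fin 3) (Fin 3) ℝ) (x : E3) (t : ℝ) : E3 :=
  (EuclideanSpace.equiv (Fin 3) ℝ).symm fun i => ∑ j, tder N j (fun p => M p i j) x t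

/-- The orthogonal projection matrix `P_Γ = I − N ⊗ N`. -/
def Pmat (N : E3 × ℝ → E3) (x : E3) (t : ℝ) : Matrix (Fin 3) (Fin 3) ℝ :=
  Matrix.of fun i j => (if i = j then (1 : ℝ) else 0) - N (x, t) i * N (x, t) j

/-- The symmetric gradient `D(φ) = ((∇φ) + (∇φ)ᵀ)/2`. -/
def Dmat (φ : E3 × ℝ → E3) (x : E3) (t : ℝ) : Matrix (Fin 3) (Fin 3) ℝ :=
  Matrix.of fun i j => (pdx i (fun p => φ p j) x t + pdx j (fun p => φ p i) x t) / 2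

/-- The surface stretching tensor `D_Γ(φ) = P_Γ D(φ) P_Γ`. -/
def DGam (N : E3 × ℝ → E3) (φ : E3 × ℝ → E3) (x : E3) (t : ℝ) : Matrix (Fin 3) (Fin 3) ℝ :=
  Pmat N x t * Dmat φ x t * Pmat N x t

/-- The squared Frobenius norm `|M|² = Σ_{i,j} M_{ij}²`. -/
def frob2 (M : Matrix (Fin 3) (Fin 3) ℝ) : ℝ := ∑ i, ∑ j, (M i j) ^ 2

/-- The material derivative `D_t f = ∂_t f + (v · ∇)f`. -/
def Dt (v : E3 × ℝ → E3) (f : E3 × ℝ → ℝ) (x : E3) (t : ℝ) : ℝ :=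
  pdt f x t + ∑ i, v (x, t) i * pdx i f x t

/-- Matrix-vector product on ℝ³. -/
def mulVec3 (M : Matrix (Fin 3) (Fin 3) ℝ) (w : E3) : E3 :=
  (EuclideanSpace.equiv (Fin 3) ℝ).symm (M.mulVec fun i => w i)

/-- The dot product on ℝ². -/
def dot2 (a b : E2) : ℝ := ∑ i, a i * b i

/-- The unit outer co-normal
`ν = ((n₁^U g₂ − n₂^U g₁)/|n₁^U g₂ − n₂^U g₁|) × n̂` at the boundary point `x̂(X,t)`,
where `n^U` is the unit outer normal of `U ⊆ ℝ²`. -/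
def conormal (xh : E2 × ℝ → E3) (nU : E2 → E2) (X : E2) (t : ℝ) : E3 :=
  cross3 (‖nU X 0 • gVec xh 1 X t - nU X 1 • gVec xh 0 X t‖⁻¹ •
      (nU X 0 • gVec xh 1 X t - nU X 1 • gVec xh 0 X t)) (nHat xh X t)

/-- `nU` is (H¹-a.e. on `∂U`) the unit outer normal of the bounded domain `U`:
it has unit length and satisfies the Gauss–Green formula on `U`. -/
def IsUnitOuterNormal (U : Set E2) (nU : E2 → E2) : Prop :=
  (∀ᵐ X ∂((μH[1] : Measure E2).restrict (frontier U)), ‖nU X‖ = 1) ∧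
  ∀ ψ : E2 → E2, ContDiff ℝ 1 ψ →
    (∫ X in U, ∑ α : Fin 2, fderiv ℝ (fun Y : E2 => ψ Y α) X (EuclideanSpace.single α 1))
      = ∫ X in frontier U, dot2 (ψ X) (nU X) ∂(μH[1] : Measure E2)

/-- The generalized surface stress tensor
`S_Γ(v,σ) = e₁'(|D_Γ(v)|²) D_Γ(v) + e₂'(|div_Γ v|²)(div_Γ v) P_Γ − σ P_Γ`. -/
def SGam (N : E3 × ℝ → E3) (v : E3 × ℝ → E3) (σ : E3 × ℝ → ℝ) (e₁ e₂ : ℝ → ℝ)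
    (x : E3) (t : ℝ) : Matrix (Fin 3) (Fin 3) ℝ :=
  deriv e₁ (frob2 (DGam N v x t)) • DGam N v x t
    + (deriv e₂ ((sdiv N v x t) ^ 2) * sdiv N v x t) • Pmat N x t
    - σ (x, t) • Pmat N x t

/-- The generalized density of energy dissipation
`ẽ_D = e₁'(|D_Γ(v)|²)|D_Γ(v)|² + e₂'(|div_Γ v|²)|div_Γ v|²`. -/
def eDtilde (N : E3 × ℝ → E3) (v : E3 × ℝ → E3) (e₁ e₂ : ℝ → ℝ) (x : E3) (t : ℝ) : ℝ :=
  deriv e₁ (frob2 (DGam N v x t)) * frob2 (DGam N v x t)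
    + deriv e₂ ((sdiv N v x t) ^ 2) * (sdiv N v x t) ^ 2

section AreaFormula

open Filter Topology Module
open scoped NNReal ENNReal

theorem hausdorffMeasure_image_le_of_edist_le {α X Y : Type*}
    [EMetricSpace X] [MeasurableSpace X] [BorelSpace X]
    [EMetricSpace Y] [MeasurableSpace Y] [BorelSpace Y]
    {f : α → X} {g : α → Y} {s : Set α} {K : ℝ≥0} {d : ℝ} (hd : 0 ≤ d)
    (h : ∀ x ∈ s, ∀ y ∈ s, edist (f x) (f y) ≤ K * edist (g x) (g y)) :
    μH[d] (f '' s) ≤ (K : ℝ≥0∞) ^ d * μH[d] (g '' s) := by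
  rcases s.eq_empty_or_nonempty with rfl | ⟨a, -⟩
  · simp
  have : Nonempty α := ⟨a⟩
  have hinv : ∀ x ∈ s, Function.invFunOn g s (g x) ∈ s ∧ g (Function.invFunOn g s (g x)) = g x :=
    fun x hx => ⟨Function.invFunOn_mem ⟨x, hx, rfl⟩, Function.invFunOn_eq ⟨x, hx, rfl⟩⟩
  have himg : f '' s = (f ∘ Function.invFunOn g s) '' (g '' s) := by
    rw [Set.image_image]
    refine Set.image_congr fun x hx => ?_
    have := h x hx _ (hinv x hx).1
    rw [(hinv x hx).2, edist_self, mul_zero, nonpos_iff_eq_zero, edist_eq_zero] at this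
    exact this
  have hlip : LipschitzOnWith K (f ∘ Function.invFunOn g s) (g '' s) := by
    rintro _ ⟨x, hx, rfl⟩ _ ⟨y, hy, rfl⟩
    have := h _ (hinv x hx).1 _ (hinv y hy).1
    rwa [(hinv x hx).2, (hinv y hy).2] at this
  rw [himg]
  exact hlip.hausdorffMeasure_image_le hd

variable {E F : Type*} [NormedAddCommGroup E] [InnerProductSpace ℝ E] [FiniteDimensional ℝ E]
  [NormedAddCommGroup F] [InnerProductSpace ℝ F]

theorem HasStrictFDerivAt.exists_nhds_edist_le {f : E → F} {f' : E →L[ℝ] F} {a : E}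
    (hf : HasStrictFDerivAt f f' a) (hf' : Function.Injective f') {K : ℝ≥0} (hK : 1 < K) :
    ∃ s ∈ 𝓝 a, ∀ x ∈ s, ∀ y ∈ s, edist (f x) (f y) ≤ K * edist (f' x) (f' y) ∧
      edist (f' x) (f' y) ≤ K * edist (f x) (f y) := by
  obtain ⟨C, hC, hlip⟩ := (f' : E →ₗ[ℝ] F).injective_iff_antilipschitz.1 hf'
  have hK' : (1 : ℝ) < K := by exact_mod_cast hK
  set δ : ℝ := 1 - (K : ℝ)⁻¹ with hδ
  have hKinv : (K : ℝ)⁻¹ < 1 := inv_lt_one_of_one_lt₀ hK'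
  have hδ0 : 0 < δ := by linarith
  have hC' : (0 : ℝ) < C := by exact_mod_cast hC
  obtain ⟨s, hs, happ⟩ := hf.approximates_deriv_on_nhds (c := (δ / C).toNNReal)
    (Or.inr (Real.toNNReal_pos.2 (div_pos hδ0 hC')))
  refine ⟨s, hs, fun x hx y hy => ?_⟩
  have h1 : ‖f x - f y - f' (x - y)‖ ≤ δ / C * ‖x - y‖ := by
    have := happ x hx y hy
    rwa [Real.coe_toNNReal _ (by positivity)] at this
  have h2 : ‖x - y‖ ≤ C * ‖f' (x - y)‖ := by
    have := hlip.le_mul_dist x y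
    simpa [dist_eq_norm] using this
  have h3 : δ / C * ‖x - y‖ ≤ δ * ‖f' (x - y)‖ := by
    calc δ / C * ‖x - y‖ ≤ δ / C * (C * ‖f' (x - y)‖) := by gcongr
      _ = δ * ‖f' (x - y)‖ := by field_simp
  have h4 : ‖f x - f y‖ ≤ (1 + δ) * ‖f' (x - y)‖ := by
    have := norm_add_le (f x - f y - f' (x - y)) (f' (x - y))
    rw [sub_add_cancel] at this
    linarith
  have h5 : (1 - δ) * ‖f' (x - y)‖ ≤ ‖f x - f y‖ := by
    have := norm_sub_norm_le (f' (x - y)) (f x - f y)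
    rw [norm_sub_rev (f' (x - y))] at this
    linarith
  have h6 : 1 + δ ≤ K := by
    have : (K : ℝ) * (K : ℝ)⁻¹ = 1 := mul_inv_cancel₀ (by linarith)
    nlinarith [sq_nonneg ((K : ℝ) - 1), inv_pos.2 (zero_lt_one.trans hK')]
  have h7 : ‖f' (x - y)‖ ≤ K * ‖f x - f y‖ := by
    have : (1 - δ) = (K : ℝ)⁻¹ := by rw [hδ]; ring
    rw [this] at h5
    rwa [inv_mul_le_iff₀ (by linarith)] at h5
  have h8 : ‖f x - f y‖ ≤ K * ‖f' (x - y)‖ := h4.trans (by gcongr)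
  rw [map_sub] at h7 h8
  simp only [edist_nndist, ← ENNReal.coe_mul, ENNReal.coe_le_coe, ← NNReal.coe_le_coe,
    NNReal.coe_mul, coe_nndist, dist_eq_norm]
  exact ⟨h8, h7⟩

variable [MeasurableSpace E] [BorelSpace E] [MeasurableSpace F] [BorelSpace F]

theorem exists_nhds_hausdorffMeasure_image_le {f : E → F} {f' : E →L[ℝ] F} {a : E}
    (hf : HasStrictFDerivAt f f' a) (hf' : Function.Injective f') {J : E → ℝ}
    (hJ : ContinuousAt J a) (hJa : J a = (f' : E →ₗ[ℝ] F).normDet) (hpos : 0 < J a)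
    {K : ℝ≥0} (hK : 1 < K) :
    ∃ V ∈ 𝓝 a, ∀ s ⊆ V, MeasurableSet s →
      μH[finrank ℝ E] (f '' s) ≤ (K : ℝ≥0∞) ^ (finrank ℝ E + 1 : ℝ) *
        ∫⁻ x in s, ENNReal.ofReal (J x) ∂μH[finrank ℝ E] ∧
      ∫⁻ x in s, ENNReal.ofReal (J x) ∂μH[finrank ℝ E] ≤
        (K : ℝ≥0∞) ^ (finrank ℝ E + 1 : ℝ) * μH[finrank ℝ E] (f '' s) := by
  obtain ⟨V, hV, hdist⟩ := hf.exists_nhds_edist_le hf' hK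
  have hK' : (1 : ℝ) < K := by exact_mod_cast hK
  have hKpow : (K : ℝ≥0∞) ^ (finrank ℝ E + 1 : ℝ) = (K : ℝ≥0∞) ^ (finrank ℝ E : ℝ) * K := by
    rw [ENNReal.rpow_add_of_nonneg _ _ (by positivity) zero_le_one, ENNReal.rpow_one]
  have hup : ∀ᶠ x in 𝓝 a, J x < K * J a := hJ.eventually_lt_const (by nlinarith)
  have hlo : ∀ᶠ x in 𝓝 a, (K : ℝ)⁻¹ * J a < J x := hJ.eventually_const_lt (by
    rw [inv_mul_lt_iff₀ (by linarith)]; nlinarith)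
  refine ⟨V ∩ ({x | J x < K * J a} ∩ {x | (K : ℝ)⁻¹ * J a < J x}),
    inter_mem hV (inter_mem hup hlo), fun s hs hsm => ?_⟩
  have hKE : ENNReal.ofReal K = K := ENNReal.ofReal_coe_nnreal
  have himg := LinearMap.hausdorffMeasure_image (f' : E →ₗ[ℝ] F) s
  rw [← hJa] at himg
  have h1 : μH[finrank ℝ E] (f '' s) ≤ (K : ℝ≥0∞) ^ (finrank ℝ E : ℝ) *
      μH[finrank ℝ E] (f' '' s) :=
    hausdorffMeasure_image_le_of_edist_le (by positivity)
      fun x hx y hy => (hdist x (hs hx).1 y (hs hy).1).1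
  have h2 : μH[finrank ℝ E] (f' '' s) ≤ (K : ℝ≥0∞) ^ (finrank ℝ E : ℝ) *
      μH[finrank ℝ E] (f '' s) :=
    hausdorffMeasure_image_le_of_edist_le (by positivity)
      fun x hx y hy => (hdist x (hs hx).1 y (hs hy).1).2
  have h3 : μH[finrank ℝ E] (f' '' s) ≤ K * ∫⁻ x in s, ENNReal.ofReal (J x) ∂μH[finrank ℝ E] := by
    refine himg.trans_le ?_
    rw [← setLIntegral_const, ← lintegral_const_mul' _ _ ENNReal.coe_ne_top]
    refine setLIntegral_mono' hsm fun x hx => ?_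
    rw [← hKE, ← ENNReal.ofReal_mul (by positivity)]
    refine ENNReal.ofReal_le_ofReal ?_
    have := (hs hx).2.2
    rw [Set.mem_ofPred_eq, inv_mul_lt_iff₀ (by linarith)] at this
    exact this.le
  have h4 : ∫⁻ x in s, ENNReal.ofReal (J x) ∂μH[finrank ℝ E] ≤ K * μH[finrank ℝ E] (f' '' s) := by
    refine le_of_le_of_eq ?_ (congrArg _ himg.symm)
    rw [← mul_assoc, ← setLIntegral_const]
    refine setLIntegral_mono' hsm fun x hx => ?_
    rw [← hKE, ← ENNReal.ofReal_mul (by positivity)]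
    exact ENNReal.ofReal_le_ofReal (hs hx).2.1.le
  rw [hKpow]
  constructor
  · rw [mul_assoc]
    exact h1.trans (by gcongr)
  · calc _ ≤ _ := h4
      _ ≤ (K : ℝ≥0∞) * ((K : ℝ≥0∞) ^ (finrank ℝ E : ℝ) * μH[finrank ℝ E] (f '' s)) := by gcongr
      _ = _ := by ring

/-- The area formula for injective immersions. -/
theorem hausdorffMeasure_image_eq_lintegral {f : E → F} {f' : E → E →L[ℝ] F} {U : Set E}
    (hU : IsOpen U) (hf : ∀ x ∈ U, HasStrictFDerivAt f (f' x) x)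
    (hf' : ∀ x ∈ U, Function.Injective (f' x)) (hinj : Set.InjOn f U) {J : E → ℝ}
    (hJ : ContinuousOn J U) (hJf : ∀ x ∈ U, J x = (f' x : E →ₗ[ℝ] F).normDet)
    (hpos : ∀ x ∈ U, 0 < J x) {s : Set E} (hsU : s ⊆ U) (hs : MeasurableSet s) :
    μH[finrank ℝ E] (f '' s) = ∫⁻ x in s, ENNReal.ofReal (J x) ∂μH[finrank ℝ E] := by
  have hcontf : ContinuousOn f U := fun x hx => (hf x hx).hasFDerivAt.continuousAt.continuousWithinAt
  have key : ∀ K : ℝ≥0, 1 < K →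
      μH[finrank ℝ E] (f '' s) ≤ (K : ℝ≥0∞) ^ (finrank ℝ E + 1 : ℝ) *
        ∫⁻ x in s, ENNReal.ofReal (J x) ∂μH[finrank ℝ E] ∧
      ∫⁻ x in s, ENNReal.ofReal (J x) ∂μH[finrank ℝ E] ≤
        (K : ℝ≥0∞) ^ (finrank ℝ E + 1 : ℝ) * μH[finrank ℝ E] (f '' s) := by
    intro K hK
    have hloc := fun x : U => exists_nhds_hausdorffMeasure_image_le (hf x x.2) (hf' x x.2)
      (hJ.continuousAt (hU.mem_nhds x.2)) (hJf x x.2) (hpos x x.2) hK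
    choose V hV hVs using hloc
    have hcov : ∃ T : Set U, T.Countable ∧ U ⊆ ⋃ x ∈ T, interior (V x) := by
      have := TopologicalSpace.isOpen_iUnion_countable (fun x : U => interior (V x))
        (fun x => isOpen_interior)
      obtain ⟨T, hT, hTU⟩ := this
      refine ⟨T, hT, ?_⟩
      rw [hTU]
      exact fun x hx => Set.mem_iUnion.2 ⟨⟨x, hx⟩, mem_interior_iff_mem_nhds.2 (hV ⟨x, hx⟩)⟩
    obtain ⟨T, hT, hTU⟩ := hcov
    rcases s.eq_empty_or_nonempty with rfl | ⟨y, hy⟩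
    · simp
    have hTne : T.Nonempty := by
      obtain ⟨x, hx, -⟩ := Set.mem_iUnion₂.1 (hTU (hsU hy))
      exact ⟨x, hx⟩
    obtain ⟨u, rfl⟩ := hT.exists_eq_range hTne
    set W : ℕ → Set E := disjointed fun n => interior (V (u n)) with hW
    have hWm : ∀ n, MeasurableSet (W n) := fun n =>
      MeasurableSet.disjointed (fun n => isOpen_interior.measurableSet) n
    have hWV : ∀ n, W n ⊆ V (u n) := fun n => (disjointed_subset _ n).trans interior_subset
    have hWd : Pairwise (Function.onFun Disjoint fun n => s ∩ W n) := fun i j hij =>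
      ((disjoint_disjointed _ hij).mono Set.inter_subset_right Set.inter_subset_right)
    have hsW : s = ⋃ n, s ∩ W n := by
      rw [← Set.inter_iUnion, hW, iUnion_disjointed, eq_comm, Set.inter_eq_left]
      refine hsU.trans (hTU.trans ?_)
      rw [Set.biUnion_range]
    have hm : ∀ n, MeasurableSet (s ∩ W n) := fun n => hs.inter (hWm n)
    have hI : ∫⁻ x in s, ENNReal.ofReal (J x) ∂μH[finrank ℝ E] =
        ∑' n, ∫⁻ x in s ∩ W n, ENNReal.ofReal (J x) ∂μH[finrank ℝ E] := by
      conv_lhs => rw [hsW]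
      exact lintegral_iUnion hm hWd _
    have hH : μH[finrank ℝ E] (f '' s) = ∑' n, μH[finrank ℝ E] (f '' (s ∩ W n)) := by
      conv_lhs => rw [hsW, Set.image_iUnion]
      refine measure_iUnion (fun i j hij => ?_) fun n => ?_
      · refine Set.disjoint_left.2 ?_
        rintro _ ⟨x, hx, rfl⟩ ⟨y, hy, hxy⟩
        obtain rfl := hinj (hsU hy.1) (hsU hx.1) hxy
        exact Set.disjoint_left.1 (hWd hij) hx hy
      · exact (hm n).image_of_continuousOn_injOn
          (hcontf.mono (Set.inter_subset_left.trans hsU))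
          (hinj.mono (Set.inter_subset_left.trans hsU))
    have hn := fun n => hVs (u n) (s ∩ W n) (Set.inter_subset_right.trans (hWV n)) (hm n)
    rw [hI, hH, ← ENNReal.tsum_mul_left, ← ENNReal.tsum_mul_left]
    exact ⟨ENNReal.tsum_le_tsum fun n => (hn n).1, ENNReal.tsum_le_tsum fun n => (hn n).2⟩
  have hle : ∀ a b : ℝ≥0∞,
      (∀ K : ℝ≥0, 1 < K → a ≤ (K : ℝ≥0∞) ^ (finrank ℝ E + 1 : ℝ) * b) → a ≤ b := by
    intro a b hab
    have hlim : Tendsto (fun K : ℝ≥0 => (K : ℝ≥0∞) ^ (finrank ℝ E + 1 : ℝ) * b) (𝓝[>] 1)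
        (𝓝 (1 * b)) := by
      refine ENNReal.Tendsto.mul_const ?_ (Or.inl one_ne_zero)
      have : Continuous fun K : ℝ≥0 => (K : ℝ≥0∞) ^ (finrank ℝ E + 1 : ℝ) :=
        ENNReal.continuous_rpow_const.comp ENNReal.continuous_coe
      simpa using (this.tendsto 1).mono_left nhdsWithin_le_nhds
    rw [one_mul] at hlim
    exact ge_of_tendsto hlim (eventually_mem_nhdsWithin.mono fun K hK => hab K hK)
  exact le_antisymm (hle _ _ fun K hK => (key K hK).1) (hle _ _ fun K hK => (key K hK).2)

/-- Change of variables for integrals over injectively immersed submanifolds. -/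
theorem integral_image_hausdorffMeasure [SecondCountableTopology F] {f : E → F}
    {f' : E → E →L[ℝ] F} {U : Set E}
    (hU : IsOpen U) (hf : ∀ x ∈ U, HasStrictFDerivAt f (f' x) x)
    (hf' : ∀ x ∈ U, Function.Injective (f' x)) (hinj : Set.InjOn f U) {J : E → ℝ}
    (hJ : ContinuousOn J U) (hJf : ∀ x ∈ U, J x = (f' x : E →ₗ[ℝ] F).normDet)
    (hpos : ∀ x ∈ U, 0 < J x) {G : Type*} [NormedAddCommGroup G] [NormedSpace ℝ G]
    {g : F → G} (hg : Continuous g) :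
    ∫ y in f '' U, g y ∂μH[finrank ℝ E] = ∫ x in U, J x • g (f x) ∂μH[finrank ℝ E] := by
  have hcontf : ContinuousOn f U := fun x hx => (hf x hx).hasFDerivAt.continuousAt.continuousWithinAt
  have hfm : AEMeasurable f ((μH[finrank ℝ E] : Measure E).restrict U) :=
    hcontf.aemeasurable hU.measurableSet
  have hJm : AEMeasurable (fun x => (J x).toNNReal) ((μH[finrank ℝ E] : Measure E).restrict U) :=
    (hJ.aemeasurable hU.measurableSet).real_toNNReal
  have hfm' : AEMeasurable f (((μH[finrank ℝ E] : Measure E).restrict U).withDensity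
      fun x => ((J x).toNNReal : ℝ≥0∞)) := hfm.mono_ac (withDensity_absolutelyContinuous _ _)
  have hmap : (μH[finrank ℝ E] : Measure F).restrict (f '' U) =
      (((μH[finrank ℝ E] : Measure E).restrict U).withDensity
        fun x => ((J x).toNNReal : ℝ≥0∞)).map f := by
    ext B hB
    obtain ⟨C, hC, hCU⟩ := (continuousOn_iff_continuous_domRestrict.1 hcontf).measurable hB
    have hCB : U ∩ f ⁻¹' B = U ∩ C := by
      ext x
      constructor
      · rintro ⟨hx, hxB⟩
        have : (⟨x, hx⟩ : U) ∈ Subtype.val ⁻¹' C := by rw [hCU]; exact hxB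
        exact ⟨hx, this⟩
      · rintro ⟨hx, hxC⟩
        have : (⟨x, hx⟩ : U) ∈ U.domRestrict f ⁻¹' B := by rw [← hCU]; exact hxC
        exact ⟨hx, this⟩
    have hm : MeasurableSet (U ∩ f ⁻¹' B) := hCB ▸ hU.measurableSet.inter hC
    rw [Measure.restrict_apply hB, Measure.map_apply_of_aemeasurable hfm' hB,
      Set.inter_comm, ← Set.image_inter_preimage,
      hausdorffMeasure_image_eq_lintegral hU hf hf' hinj hJ hJf hpos Set.inter_subset_left hm]
    rw [withDensity_apply', Measure.restrict_restrict₀ (hfm.nullMeasurable hB), Set.inter_comm]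
    rfl
  rw [hmap, integral_map hfm' hg.aestronglyMeasurable,
    integral_withDensity_eq_integral_smul₀ hJm]
  refine setIntegral_congr_fun hU.measurableSet fun x hx => ?_
  simp [NNReal.smul_def, (hpos x hx).le]

end AreaFormula

section SurfaceCalculus

@[simp] theorem cross3_apply_zero (a b : E3) : cross3 a b 0 = a 1 * b 2 - a 2 * b 1 := rfl
@[simp] theorem cross3_apply_one (a b : E3) : cross3 a b 1 = a 2 * b 0 - a 0 * b 2 := rfl
@[simp] theorem cross3_apply_two (a b : E3) : cross3 a b 2 = a 0 * b 1 - a 1 * b 0 := rfl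

theorem dot3_eq (a b : E3) : dot3 a b = a 0 * b 0 + a 1 * b 1 + a 2 * b 2 := by
  simp [dot3, Fin.sum_univ_three]

theorem dot3_self (a : E3) : dot3 a a = ‖a‖ ^ 2 := by
  rw [EuclideanSpace.norm_sq_eq, dot3]
  simp [pow_two]

theorem dot3_eq_inner (a b : E3) : dot3 a b = inner ℝ a b := by
  simp [dot3, PiLp.inner_apply, mul_comm]

theorem norm_cross3_sq (a b : E3) :
    ‖cross3 a b‖ ^ 2 = dot3 a a * dot3 b b - dot3 a b * dot3 b a := by
  rw [← dot3_self]
  simp only [dot3_eq, cross3_apply_zero, cross3_apply_one, cross3_apply_two]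
  ring

theorem dot3_cross3_eq_zero_of_orthogonal {a b c n : E3} (hn : dot3 n n = 1)
    (ha : dot3 a n = 0) (hb : dot3 b n = 0) (hc : dot3 c n = 0) : dot3 a (cross3 b c) = 0 := by
  have key : dot3 a (cross3 b c) * dot3 n n = dot3 a n * dot3 n (cross3 b c)
      + dot3 b n * dot3 n (cross3 c a) + dot3 c n * dot3 n (cross3 a b) := by
    simp only [dot3_eq, cross3_apply_zero, cross3_apply_one, cross3_apply_two]
    ring
  rw [hn, ha, hb, hc] at key
  linarith

/-- The tangential trace of a matrix, expressed through a frame `a, b` with `a × b = J n`. -/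
theorem frame_trace_eq {a b n : E3} {J : ℝ} (hn : dot3 n n = 1) (hJ : cross3 a b = J • n)
    (A : Fin 3 → Fin 3 → ℝ) :
    (∑ j, (∑ k, a k * A k j) * cross3 b n j) - ∑ j, (∑ k, b k * A k j) * cross3 a n j
      = J * ∑ j, ∑ i, ((if i = j then (1 : ℝ) else 0) - n i * n j) * A i j := by
  have h0 : a 1 * b 2 - a 2 * b 1 = J * n 0 := congrArg (fun x : E3 => x 0) hJ
  have h1 : a 2 * b 0 - a 0 * b 2 = J * n 1 := congrArg (fun x : E3 => x 1) hJ
  have h2 : a 0 * b 1 - a 1 * b 0 = J * n 2 := congrArg (fun x : E3 => x 2) hJ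
  rw [dot3_eq] at hn
  simp [Fin.sum_univ_three]
  linear_combination
    h0 * ((A 0 0 + A 1 1 + A 2 2) * n 0 - (A 0 0 * n 0 + A 1 0 * n 1 + A 2 0 * n 2))
    + h1 * ((A 0 0 + A 1 1 + A 2 2) * n 1 - (A 0 1 * n 0 + A 1 1 * n 1 + A 2 1 * n 2))
    + h2 * ((A 0 0 + A 1 1 + A 2 2) * n 2 - (A 0 2 * n 0 + A 1 2 * n 1 + A 2 2 * n 2))
    + J * (A 0 0 + A 1 1 + A 2 2) * hn

theorem hasFDerivAt_apply_comp {A : Type*} [NormedAddCommGroup A] [NormedSpace ℝ A] {ι : Type*}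
    [Fintype ι] {f : A → EuclideanSpace ℝ ι} {f' : A →L[ℝ] EuclideanSpace ℝ ι} {X : A}
    (hf : HasFDerivAt f f' X) (i : ι) :
    HasFDerivAt (fun Y => f Y i) ((EuclideanSpace.proj i : _ →L[ℝ] ℝ).comp f') X :=
  (EuclideanSpace.proj i : EuclideanSpace ℝ ι →L[ℝ] ℝ).hasFDerivAt.comp X hf

theorem hasFDerivAt_cross3 {A : Type*} [NormedAddCommGroup A] [NormedSpace ℝ A]
    {b c : A → E3} {b' c' : A →L[ℝ] E3} {X : A}
    (hb : HasFDerivAt b b' X) (hc : HasFDerivAt c c' X) :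
    ∃ d' : A →L[ℝ] E3, HasFDerivAt (fun Y => cross3 (b Y) (c Y)) d' X ∧
      ∀ u, d' u = cross3 (b' u) (c X) + cross3 (b X) (c' u) := by
  have hb' := hasFDerivAt_apply_comp hb
  have hc' := hasFDerivAt_apply_comp hc
  have hd : DifferentiableAt ℝ (fun Y => cross3 (b Y) (c Y)) X := by
    rw [differentiableAt_euclidean]
    intro i
    fin_cases i
    · exact (((hb' 1).mul (hc' 2)).sub ((hb' 2).mul (hc' 1))).differentiableAt
    · exact (((hb' 2).mul (hc' 0)).sub ((hb' 0).mul (hc' 2))).differentiableAt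
    · exact (((hb' 0).mul (hc' 1)).sub ((hb' 1).mul (hc' 0))).differentiableAt
  refine ⟨_, hd.hasFDerivAt, fun u => ?_⟩
  have hcomp := hasFDerivAt_apply_comp hd.hasFDerivAt
  ext i
  fin_cases i
  · have := DFunLike.congr_fun
      ((hcomp 0).unique (((hb' 1).mul (hc' 2)).sub ((hb' 2).mul (hc' 1)))) u
    simp at this ⊢
    linarith
  · have := DFunLike.congr_fun
      ((hcomp 1).unique (((hb' 2).mul (hc' 0)).sub ((hb' 0).mul (hc' 2)))) u
    simp at this ⊢
    linarith
  · have := DFunLike.congr_fun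
      ((hcomp 2).unique (((hb' 0).mul (hc' 1)).sub ((hb' 1).mul (hc' 0)))) u
    simp at this ⊢
    linarith

theorem hasFDerivAt_dot3 {A : Type*} [NormedAddCommGroup A] [NormedSpace ℝ A]
    {b c : A → E3} {b' c' : A →L[ℝ] E3} {X : A}
    (hb : HasFDerivAt b b' X) (hc : HasFDerivAt c c' X) :
    ∃ d' : A →L[ℝ] ℝ, HasFDerivAt (fun Y => dot3 (b Y) (c Y)) d' X ∧
      ∀ u, d' u = dot3 (b' u) (c X) + dot3 (b X) (c' u) := by
  simp only [dot3_eq_inner]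
  refine ⟨_, hb.inner ℝ hc, fun u => ?_⟩
  simp [fderivInnerCLM_apply, add_comm]

theorem hasFDerivAt_dot3_cross3 {A : Type*} [NormedAddCommGroup A] [NormedSpace ℝ A]
    {a b c : A → E3} {a' b' c' : A →L[ℝ] E3} {X : A} (ha : HasFDerivAt a a' X)
    (hb : HasFDerivAt b b' X) (hc : HasFDerivAt c c' X) :
    ∃ d' : A →L[ℝ] ℝ, HasFDerivAt (fun Y => dot3 (a Y) (cross3 (b Y) (c Y))) d' X ∧
      ∀ u, d' u = dot3 (a' u) (cross3 (b X) (c X)) + dot3 (a X) (cross3 (b' u) (c X))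
        + dot3 (a X) (cross3 (b X) (c' u)) := by
  obtain ⟨m, hm, hm'⟩ := hasFDerivAt_cross3 hb hc
  obtain ⟨d, hd, hd'⟩ := hasFDerivAt_dot3 ha hm
  refine ⟨d, hd, fun u => ?_⟩
  rw [hd', hm', add_assoc]
  simp only [dot3_eq, PiLp.add_apply]
  ring

theorem contDiff_cross3 {A : Type*} [NormedAddCommGroup A] [NormedSpace ℝ A] {n : WithTop ℕ∞}
    {b c : A → E3} (hb : ContDiff ℝ n b) (hc : ContDiff ℝ n c) :
    ContDiff ℝ n fun Y => cross3 (b Y) (c Y) := by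
  have hb' := contDiff_euclidean.1 hb
  have hc' := contDiff_euclidean.1 hc
  refine contDiff_euclidean.2 fun i => ?_
  fin_cases i
  · exact ((hb' 1).mul (hc' 2)).sub ((hb' 2).mul (hc' 1))
  · exact ((hb' 2).mul (hc' 0)).sub ((hb' 0).mul (hc' 2))
  · exact ((hb' 0).mul (hc' 1)).sub ((hb' 1).mul (hc' 0))

theorem contDiff_dot3 {A : Type*} [NormedAddCommGroup A] [NormedSpace ℝ A] {n : WithTop ℕ∞}
    {b c : A → E3} (hb : ContDiff ℝ n b) (hc : ContDiff ℝ n c) :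
    ContDiff ℝ n fun Y => dot3 (b Y) (c Y) := by
  simp only [dot3_eq_inner]
  exact hb.inner ℝ hc

section Slices

variable {A B : Type*} [NormedAddCommGroup A] [NormedSpace ℝ A]
  [NormedAddCommGroup B] [NormedSpace ℝ B]

theorem HasFDerivAt.slice_left {f : A × ℝ → B} {f' : A × ℝ →L[ℝ] B} {X : A} {t : ℝ}
    (hf : HasFDerivAt f f' (X, t)) :
    HasFDerivAt (fun Y => f (Y, t)) (f'.comp (ContinuousLinearMap.inl ℝ A ℝ)) X :=
  hf.comp X (hasFDerivAt_prodMk_left X t)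

theorem HasFDerivAt.slice_right {f : A × ℝ → B} {f' : A × ℝ →L[ℝ] B} {X : A} {t : ℝ}
    (hf : HasFDerivAt f f' (X, t)) :
    HasDerivAt (fun s => f (X, s)) (f' (0, 1)) t := by
  have := (hf.comp t (hasFDerivAt_prodMk_right X t)).hasDerivAt
  simpa [Function.comp_def] using this

theorem fderiv_slice_swap {f : A × ℝ → B} (hf : ContDiff ℝ 2 f) (p u w : A × ℝ) :
    fderiv ℝ (fderiv ℝ f) p u w = fderiv ℝ (fderiv ℝ f) p w u :=
  (hf.contDiffAt.isSymmSndFDerivAt (by simp)).eq u w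

theorem hasFDerivAt_fderiv_apply {f : A × ℝ → B} (hf : ContDiff ℝ 2 f) (p w : A × ℝ) :
    HasFDerivAt (fun q => fderiv ℝ f q w) ((fderiv ℝ (fderiv ℝ f) p).flip w) p := by
  have h : ContDiff ℝ 1 (fderiv ℝ f) := hf.fderiv_right (by norm_num)
  have h1 := (h.differentiable one_ne_zero p).hasFDerivAt
  have := h1.clm_apply (hasFDerivAt_const w p)
  simpa using this

end Slices

theorem gVec_eq {xh : E2 × ℝ → E3} (hxh : ContDiff ℝ 2 xh) (α : Fin 2) (X : E2) (t : ℝ) :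
    gVec xh α X t = fderiv ℝ xh (X, t) (EuclideanSpace.single α 1, 0) := by
  have := (hxh.differentiable two_ne_zero (X, t)).hasFDerivAt.slice_left.fderiv
  rw [gVec, this]
  rfl

theorem contDiff_gVec {xh : E2 × ℝ → E3} (hxh : ContDiff ℝ 2 xh) (α : Fin 2) :
    ContDiff ℝ 1 fun p : E2 × ℝ => gVec xh α p.1 p.2 := by
  simp only [gVec_eq hxh]
  exact (hxh.fderiv_right (by norm_num)).clm_apply contDiff_const

theorem hasFDerivAt_gVec {xh : E2 × ℝ → E3} (hxh : ContDiff ℝ 2 xh) (α : Fin 2) (p : E2 × ℝ) :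
    HasFDerivAt (fun p : E2 × ℝ => gVec xh α p.1 p.2)
      ((fderiv ℝ (fderiv ℝ xh) p).flip (EuclideanSpace.single α 1, 0)) p := by
  simp only [gVec_eq hxh]
  exact hasFDerivAt_fderiv_apply hxh p _

theorem pdx_eq {f : E3 × ℝ → ℝ} {x : E3} {t : ℝ} (hf : DifferentiableAt ℝ f (x, t)) (j : Fin 3) :
    pdx j f x t = fderiv ℝ f (x, t) (EuclideanSpace.single j 1, 0) := by
  rw [pdx, hf.hasFDerivAt.slice_left.fderiv]
  rfl

theorem pdt_eq {f : E3 × ℝ → ℝ} {x : E3} {t : ℝ} (hf : DifferentiableAt ℝ f (x, t)) :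
    pdt f x t = fderiv ℝ f (x, t) (0, 1) :=
  hf.hasFDerivAt.slice_right.deriv

theorem sum_smul_single (y : E3) : ∑ k, y k • EuclideanSpace.single k (1 : ℝ) = y := by
  ext i
  simp [Fin.sum_univ_three]
  fin_cases i <;> simp

theorem fderiv_apply_space_eq_sum {f : E3 × ℝ → ℝ} {x : E3} {t : ℝ}
    (hf : DifferentiableAt ℝ f (x, t)) (y : E3) :
    fderiv ℝ f (x, t) (y, 0) = ∑ k, y k * pdx k f x t := by
  have h : ((y, 0) : E3 × ℝ) = ∑ k, y k • ((EuclideanSpace.single k (1 : ℝ), 0) : E3 × ℝ) := by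
    ext1
    · simpa [Prod.fst_sum] using (sum_smul_single y).symm
    · simp [Prod.snd_sum]
  rw [h, map_sum]
  simp only [map_smul, smul_eq_mul, pdx_eq hf]

theorem fderiv_apply_material {f : E3 × ℝ → ℝ} {x : E3} {t : ℝ}
    (hf : DifferentiableAt ℝ f (x, t)) (v : E3 × ℝ → E3) :
    fderiv ℝ f (x, t) (v (x, t), 1) = Dt v f x t := by
  have h : ((v (x, t), 1) : E3 × ℝ) = (0, 1) + (v (x, t), 0) := by simp
  rw [h, map_add, fderiv_apply_space_eq_sum hf, Dt, pdt_eq hf]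

end SurfaceCalculus

section SurfaceFields

open scoped Topology

/-- The area density `√G`, written as the triple product of the normal and the tangent vectors. -/
def areaDensity (xh : E2 × ℝ → E3) (N : E3 × ℝ → E3) (X : E2) (t : ℝ) : ℝ :=
  dot3 (N (xh (X, t), t))
    (cross3 (gVec xh 0 X t) (gVec xh 1 X t))

variable {xh : E2 × ℝ → E3} {N : E3 × ℝ → E3} {X : E2} {t : ℝ}

theorem norm_cross3_gVec_sq : ‖cross3 (gVec xh 0 X t) (gVec xh 1 X t)‖ ^ 2 = Gdet xh X t := by
  rw [norm_cross3_sq]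
  rfl

theorem areaDensity_eq_norm (hN : N (xh (X, t), t) = nHat xh X t)
    (hN1 : ‖N (xh (X, t), t)‖ = 1) :
    areaDensity xh N X t = ‖cross3 (gVec xh 0 X t) (gVec xh 1 X t)‖ := by
  rw [areaDensity, hN, nHat, dot3_eq_inner, real_inner_smul_left, real_inner_self_eq_norm_sq]
  have h : ‖cross3 (gVec xh 0 X t) (gVec xh 1 X t)‖ ≠ 0 := by
    intro h
    rw [hN, nHat, h] at hN1
    simp at hN1
  field_simp

theorem cross3_gVec_eq_areaDensity_smul (hN : N (xh (X, t), t) = nHat xh X t)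
    (hN1 : ‖N (xh (X, t), t)‖ = 1) :
    cross3 (gVec xh 0 X t) (gVec xh 1 X t) = areaDensity xh N X t • N (xh (X, t), t) := by
  have h : ‖cross3 (gVec xh 0 X t) (gVec xh 1 X t)‖ ≠ 0 := by
    intro h
    rw [hN, nHat, h] at hN1
    simp at hN1
  rw [areaDensity_eq_norm hN hN1, hN, nHat, smul_inv_smul₀ h]

theorem contDiff_areaDensity (hxh : ContDiff ℝ 2 xh) (hN : ContDiff ℝ 1 N) :
    ContDiff ℝ 1 fun p : E2 × ℝ => areaDensity xh N p.1 p.2 := by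
  have h : ContDiff ℝ 1 fun p : E2 × ℝ => N (xh (p.1, p.2), p.2) :=
    hN.comp ((hxh.of_le one_le_two).prodMk contDiff_snd)
  exact contDiff_dot3 h (contDiff_cross3 (contDiff_gVec hxh 0) (contDiff_gVec hxh 1))

theorem dot3_gVec_eq_zero {n : E3} {J : ℝ} (hJ : J ≠ 0)
    (hframe : cross3 (gVec xh 0 X t) (gVec xh 1 X t) = J • n) (α : Fin 2) :
    dot3 (gVec xh α X t) n = 0 := by
  have h : dot3 (gVec xh α X t) (J • n) = 0 := by
    rw [← hframe]
    fin_cases α <;>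
    · simp only [dot3_eq, cross3_apply_zero, cross3_apply_one, cross3_apply_two,
        Fin.zero_eta, Fin.mk_one]
      ring
  rw [dot3_eq_inner, real_inner_smul_right] at h
  rw [dot3_eq_inner]
  exact (mul_eq_zero.1 h).resolve_left hJ

theorem hasFDerivAt_comp_surface {B : Type*} [NormedAddCommGroup B] [NormedSpace ℝ B]
    {f : E3 × ℝ → B} (hf : Differentiable ℝ f) (hxh : ContDiff ℝ 2 xh) (X : E2) (t : ℝ) :
    ∃ d : E2 →L[ℝ] B, HasFDerivAt (fun Y => f (xh (Y, t), t)) d X ∧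
      ∀ α, d (EuclideanSpace.single α 1) = fderiv ℝ f (xh (X, t), t) (gVec xh α X t, 0) := by
  have h1 := (hxh.differentiable two_ne_zero (X, t)).hasFDerivAt.slice_left
  have h2 := h1.prodMk (hasFDerivAt_const t X)
  refine ⟨_, ((hf (xh (X, t), t)).hasFDerivAt.comp X h2 :), fun α => ?_⟩
  rw [gVec_eq hxh]
  rfl

theorem hasDerivAt_comp_surface {B : Type*} [NormedAddCommGroup B] [NormedSpace ℝ B]
    {f : E3 × ℝ → B} (hf : Differentiable ℝ f) (hxh : ContDiff ℝ 2 xh) {v : E3 × ℝ → E3}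
    (hflow : deriv (fun s => xh (X, s)) t = v (xh (X, t), t)) :
    HasDerivAt (fun s => f (xh (X, s), s)) (fderiv ℝ f (xh (X, t), t) (v (xh (X, t), t), 1)) t := by
  have h1 := (hxh.differentiable two_ne_zero (X, t)).hasFDerivAt.slice_right
  rw [← h1.deriv.symm.trans hflow]
  exact (hf (xh (X, t), t)).hasFDerivAt.comp_hasDerivAt_of_eq t (h1.prodMk (hasDerivAt_id t)) rfl

theorem fderiv_apply_component {q : E3 × ℝ → E3} {p : E3 × ℝ} (hq : DifferentiableAt ℝ q p)
    (u : E3 × ℝ) (j : Fin 3) : fderiv ℝ q p u j = fderiv ℝ (fun p => q p j) p u := by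
  rw [(hasFDerivAt_apply_comp hq.hasFDerivAt j).fderiv]
  rfl

theorem fderiv_apply_space_component {q : E3 × ℝ → E3} {x : E3} (hq : DifferentiableAt ℝ q (x, t))
    (y : E3) (j : Fin 3) :
    fderiv ℝ q (x, t) (y, 0) j = ∑ k, y k * pdx k (fun p => q p j) x t := by
  rw [fderiv_apply_component hq, fderiv_apply_space_eq_sum]
  exact (hasFDerivAt_apply_comp hq.hasFDerivAt j).differentiableAt

theorem sdiv_eq_frame {q : E3 × ℝ → E3} {x : E3} (hq : DifferentiableAt ℝ q (x, t))
    {a b : E3} {J : ℝ} (hn : dot3 (N (x, t)) (N (x, t)) = 1) (hJ : cross3 a b = J • N (x, t)) :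
    dot3 (fderiv ℝ q (x, t) (a, 0)) (cross3 b (N (x, t)))
      - dot3 (fderiv ℝ q (x, t) (b, 0)) (cross3 a (N (x, t))) = J * sdiv N q x t := by
  have := frame_trace_eq hn hJ fun k j => pdx k (fun p => q p j) x t
  simp only [dot3, fderiv_apply_space_component hq]
  exact this

theorem dot3_deriv_eq_zero_of_dot3_self {A : Type*} [NormedAddCommGroup A] [NormedSpace ℝ A]
    {n : A → E3} {n' : A →L[ℝ] E3} {X : A} (hn : HasFDerivAt n n' X)
    (h : ∀ᶠ Y in 𝓝 X, dot3 (n Y) (n Y) = 1) (u : A) : dot3 (n' u) (n X) = 0 := by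
  obtain ⟨d, hd, hd'⟩ := hasFDerivAt_dot3 hn hn
  have h0 : d = 0 := hd.unique ((hasFDerivAt_const (1 : ℝ) X).congr_of_eventuallyEq h)
  have := hd' u
  rw [h0] at this
  simp only [dot3_eq, zero_apply] at this ⊢
  linarith

/-- The pulled-back divergence of a tangential field is the area density times the surface
divergence. -/
theorem fderiv_pullback_eq_sdiv {q : E3 × ℝ → E3} (hxh : ContDiff ℝ 2 xh) (hN : ContDiff ℝ 1 N)
    (hq : ContDiff ℝ 1 q) {J : ℝ} (hJ : J ≠ 0)
    (hn : ∀ᶠ Y in 𝓝 X, dot3 (N (xh (Y, t), t)) (N (xh (Y, t), t)) = 1)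
    (hframe : cross3 (gVec xh 0 X t) (gVec xh 1 X t) = J • N (xh (X, t), t))
    (hqN : dot3 (q (xh (X, t), t)) (N (xh (X, t), t)) = 0) :
    fderiv ℝ (fun Y => dot3 (q (xh (Y, t), t)) (cross3 (gVec xh 1 Y t) (N (xh (Y, t), t)))) X
        (EuclideanSpace.single 0 1)
      - fderiv ℝ (fun Y => dot3 (q (xh (Y, t), t)) (cross3 (gVec xh 0 Y t) (N (xh (Y, t), t)))) X
        (EuclideanSpace.single 1 1)
      = J * sdiv N q (xh (X, t)) t := by
  have hq1 := hq.differentiable one_ne_zero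
  obtain ⟨q', hq', hqe⟩ := hasFDerivAt_comp_surface hq1 hxh X t
  obtain ⟨n', hn', hne⟩ := hasFDerivAt_comp_surface (hN.differentiable one_ne_zero) hxh X t
  have hg := fun α => (hasFDerivAt_gVec hxh α (X, t)).slice_left
  obtain ⟨d, hd, hde⟩ := hasFDerivAt_dot3_cross3 hq' (hg 1) hn'
  obtain ⟨e, he, hee⟩ := hasFDerivAt_dot3_cross3 hq' (hg 0) hn'
  have hnX := hn.self_of_nhds
  have hz := fun α (u : E2) => dot3_cross3_eq_zero_of_orthogonal hnX hqN
    (dot3_gVec_eq_zero hJ hframe α) (dot3_deriv_eq_zero_of_dot3_self hn' hn u)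
  have hsw := fderiv_slice_swap hxh (X, t) (EuclideanSpace.single 0 1, 0)
    (EuclideanSpace.single 1 1, 0)
  rw [hd.fderiv, he.fderiv, hde, hee, hz, hz, hqe, hqe,
    ← sdiv_eq_frame (hq1 _) hnX hframe]
  simp only [ContinuousLinearMap.comp_apply, ContinuousLinearMap.inl_apply,
    ContinuousLinearMap.flip_apply, hsw]
  ring

/-- The area density evolves by the surface divergence of the velocity. -/
theorem hasDerivAt_areaDensity (hxh : ContDiff ℝ 2 xh) (hN : ContDiff ℝ 1 N)
    {v : E3 × ℝ → E3} (hv : ContDiff ℝ 2 v)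
    (hn : ∀ᶠ s in 𝓝 t, dot3 (N (xh (X, s), s)) (N (xh (X, s), s)) = 1)
    (hframe : cross3 (gVec xh 0 X t) (gVec xh 1 X t) = areaDensity xh N X t • N (xh (X, t), t))
    (hflow : ∀ᶠ Y in 𝓝 X, deriv (fun s => xh (Y, s)) t = v (xh (Y, t), t)) :
    HasDerivAt (fun s => areaDensity xh N X s)
      (areaDensity xh N X t * sdiv N v (xh (X, t)) t) t := by
  have hv1 := hv.differentiable two_ne_zero
  have hg : ∀ α, HasDerivAt (fun s => gVec xh α X s)
      (fderiv ℝ v (xh (X, t), t) (gVec xh α X t, 0)) t := by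
    intro α
    have h1 := (hasFDerivAt_gVec hxh α (X, t)).slice_right
    have h2 := (hasFDerivAt_fderiv_apply hxh (X, t) (0, 1)).slice_left
    obtain ⟨v', hv', hve⟩ := hasFDerivAt_comp_surface hv1 hxh X t
    have h3 := h2.unique (hv'.congr_of_eventuallyEq (hflow.mono fun Y hY => by
      beta_reduce
      rw [← hY, (hxh.differentiable two_ne_zero (Y, t)).hasFDerivAt.slice_right.deriv]))
    have h4 := DFunLike.congr_fun h3 (EuclideanSpace.single α 1)
    rw [hve] at h4
    rw [← h4]
    simp only [ContinuousLinearMap.comp_apply, ContinuousLinearMap.inl_apply,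
      ContinuousLinearMap.flip_apply] at h1 ⊢
    rwa [fderiv_slice_swap hxh]
  have hnd := (hasDerivAt_comp_surface (hN.differentiable one_ne_zero) hxh
    hflow.self_of_nhds).hasFDerivAt
  obtain ⟨d, hd, hde⟩ := hasFDerivAt_dot3_cross3 hnd (hg 0).hasFDerivAt (hg 1).hasFDerivAt
  have hz := dot3_deriv_eq_zero_of_dot3_self hnd hn 1
  have hd1 := hd.hasDerivAt
  rw [hde, hframe] at hd1
  refine hd1.congr_deriv ?_
  rw [← sdiv_eq_frame (hv1 _) hn.self_of_nhds hframe]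
  simp only [ContinuousLinearMap.toSpanSingleton_apply, one_smul] at hz ⊢
  rw [dot3_eq_inner _ (_ • _), real_inner_smul_right, ← dot3_eq_inner, hz]
  simp only [dot3_eq, cross3_apply_zero, cross3_apply_one, cross3_apply_two]
  ring

end SurfaceFields

section Stress

variable {N v : E3 × ℝ → E3} {σ : E3 × ℝ → ℝ} {e₁ e₂ : ℝ → ℝ} {x : E3} {t : ℝ}

theorem Pmat_transpose : (Pmat N x t).transpose = Pmat N x t := by
  ext i j
  simp [Pmat, mul_comm, eq_comm]

theorem Dmat_transpose : (Dmat v x t).transpose = Dmat v x t := by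
  ext i j
  simp [Dmat, add_comm]

theorem DGam_transpose : (DGam N v x t).transpose = DGam N v x t := by
  rw [DGam, Matrix.transpose_mul, Matrix.transpose_mul, Pmat_transpose, Dmat_transpose,
    Matrix.mul_assoc]

theorem SGam_symm (i j : Fin 3) : SGam N v σ e₁ e₂ x t i j = SGam N v σ e₁ e₂ x t j i := by
  have h : (SGam N v σ e₁ e₂ x t).transpose = SGam N v σ e₁ e₂ x t := by
    simp [SGam, Matrix.transpose_sub, Matrix.transpose_add, Matrix.transpose_smul,
      DGam_transpose, Pmat_transpose]
  exact congrFun (congrFun h j) i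

theorem Pmat_mulVec_normal (hn : dot3 (N (x, t)) (N (x, t)) = 1) :
    (Pmat N x t).mulVec (N (x, t)) = 0 := by
  rw [dot3_eq] at hn
  ext i
  simp only [Matrix.mulVec, dotProduct, Pmat, Matrix.of_apply, Fin.sum_univ_three, Pi.zero_apply]
  fin_cases i <;> simp <;> linear_combination (-N (x, t) _) * hn

theorem SGam_mulVec_normal (hn : dot3 (N (x, t)) (N (x, t)) = 1) (i : Fin 3) :
    ∑ j, SGam N v σ e₁ e₂ x t i j * N (x, t) j = 0 := by
  have h : (SGam N v σ e₁ e₂ x t).mulVec (N (x, t)) = 0 := by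
    simp [SGam, DGam, Matrix.sub_mulVec, Matrix.add_mulVec, Matrix.smul_mulVec,
      ← Matrix.mulVec_mulVec, Pmat_mulVec_normal hn]
  exact congrFun h i

theorem contDiff_pdx {f : E3 × ℝ → ℝ} (hf : ContDiff ℝ 2 f) (j : Fin 3) :
    ContDiff ℝ 1 fun p : E3 × ℝ => pdx j f p.1 p.2 := by
  simp only [pdx_eq (hf.differentiable two_ne_zero _)]
  exact (hf.fderiv_right (by norm_num)).clm_apply contDiff_const

theorem contDiff_sdiv (hN : ContDiff ℝ 1 N) (hv : ContDiff ℝ 2 v) :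
    ContDiff ℝ 1 fun p : E3 × ℝ => sdiv N v p.1 p.2 := by
  have hN' := contDiff_euclidean.1 hN
  refine ContDiff.sum fun j _ => ContDiff.sum fun i _ => ?_
  exact (contDiff_const.sub ((hN' i).mul (hN' j))).mul (contDiff_pdx (contDiff_euclidean.1 hv j) i)

theorem contDiff_Pmat (hN : ContDiff ℝ 1 N) (i j : Fin 3) :
    ContDiff ℝ 1 fun p : E3 × ℝ => Pmat N p.1 p.2 i j := by
  have hN' := contDiff_euclidean.1 hN
  exact contDiff_const.sub ((hN' i).mul (hN' j))

theorem contDiff_DGam (hN : ContDiff ℝ 1 N) (hv : ContDiff ℝ 2 v) (i j : Fin 3) :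
    ContDiff ℝ 1 fun p : E3 × ℝ => DGam N v p.1 p.2 i j := by
  simp only [DGam, Matrix.mul_apply]
  refine ContDiff.sum fun k _ => (ContDiff.sum fun l _ => ?_).mul (contDiff_Pmat hN k j)
  exact (contDiff_Pmat hN i l).mul (((contDiff_pdx (contDiff_euclidean.1 hv k) l).add
    (contDiff_pdx (contDiff_euclidean.1 hv l) k)).div_const 2)

theorem contDiff_SGam (hN : ContDiff ℝ 1 N) (hv : ContDiff ℝ 2 v) (hσ : ContDiff ℝ 2 σ)
    (he₁ : ContDiff ℝ 2 e₁) (he₂ : ContDiff ℝ 2 e₂) (i j : Fin 3) :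
    ContDiff ℝ 1 fun p : E3 × ℝ => SGam N v σ e₁ e₂ p.1 p.2 i j := by
  have hde : ∀ e : ℝ → ℝ, ContDiff ℝ 2 e → ContDiff ℝ 1 (deriv e) := fun e he =>
    ((contDiff_succ_iff_deriv (n := 1)).1 (by simpa [one_add_one_eq_two] using he)).2.2
  have hf : ContDiff ℝ 1 fun p : E3 × ℝ => frob2 (DGam N v p.1 p.2) :=
    ContDiff.sum fun k _ => ContDiff.sum fun l _ => (contDiff_DGam hN hv k l).pow 2
  have hd := contDiff_sdiv hN hv
  have hP := contDiff_Pmat hN i j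
  exact ((((hde _ he₁).comp hf).mul (contDiff_DGam hN hv i j)).add
    ((((hde _ he₂).comp (hd.pow 2)).mul hd).mul hP)).sub ((hσ.of_le one_le_two).mul hP)

theorem equiv_symm_coord (f : Fin 3 → ℝ) (i : Fin 3) :
    (EuclideanSpace.equiv (Fin 3) ℝ).symm f i = f i := rfl

/-- The flux of a matrix field `S` tested against the vector field `w`. -/
def stressFlux (S : E3 × ℝ → Matrix (Fin 3) (Fin 3) ℝ) (w : E3 → E3) (p : E3 × ℝ) : E3 :=
  WithLp.toLp 2 fun j => ∑ l, w p.1 l * S p l j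

theorem contDiff_stressFlux {S : E3 × ℝ → Matrix (Fin 3) (Fin 3) ℝ} {w : E3 → E3}
    (hS : ∀ i j, ContDiff ℝ 1 fun p => S p i j) (hw : ContDiff ℝ 1 w) :
    ContDiff ℝ 1 (stressFlux S w) := by
  refine contDiff_euclidean.2 fun j => ?_
  change ContDiff ℝ 1 fun p : E3 × ℝ => ∑ l, w p.1 l * S p l j
  exact ContDiff.sum fun l _ =>
    (contDiff_euclidean.1 (hw.comp contDiff_fst) l).mul (hS l j)

theorem dot3_stressFlux (S : E3 × ℝ → Matrix (Fin 3) (Fin 3) ℝ) (w : E3 → E3) (p : E3 × ℝ)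
    (u : E3) : dot3 (stressFlux S w p) u = dot3 (w p.1) (mulVec3 (S p) u) := by
  simp only [dot3, stressFlux, mulVec3, Matrix.mulVec, dotProduct,
    equiv_symm_coord, Fin.sum_univ_three]
  ring

/-- The velocity field of an infinitesimal rigid motion. -/
def rigidField (a b : E3) (x : E3) : E3 := a + cross3 b x

theorem contDiff_rigidField (a b : E3) {n : WithTop ℕ∞} : ContDiff ℝ n (rigidField a b) :=
  contDiff_const.add (contDiff_cross3 contDiff_const contDiff_id)

theorem hasFDerivAt_rigidField (a b : E3) (p : E3 × ℝ) :
    ∃ d : E3 × ℝ →L[ℝ] E3, HasFDerivAt (fun p : E3 × ℝ => rigidField a b p.1) d p ∧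
      ∀ u, d u = cross3 b u.1 := by
  obtain ⟨d, hd, hde⟩ := hasFDerivAt_cross3 (hasFDerivAt_const b p)
    (hasFDerivAt_fst (𝕜 := ℝ) (p := p))
  refine ⟨d, hd.const_add a, fun u => ?_⟩
  rw [hde]
  ext i
  fin_cases i <;> simp

theorem pdx_stressFlux {S : E3 × ℝ → Matrix (Fin 3) (Fin 3) ℝ}
    (hS : ∀ i j, ContDiff ℝ 1 fun p => S p i j) (a b : E3) (i j : Fin 3) :
    pdx i (fun p => stressFlux S (rigidField a b) p j) x t =
      ∑ l, (rigidField a b x l * pdx i (fun p => S p l j) x t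
        + S (x, t) l j * cross3 b (EuclideanSpace.single i 1) l) := by
  obtain ⟨d, hd, hde⟩ := hasFDerivAt_rigidField a b (x, t)
  have hS' := fun l => (hS l j).differentiable one_ne_zero (x, t)
  have h := HasFDerivAt.fun_sum (u := Finset.univ) fun l _ =>
    (hasFDerivAt_apply_comp hd l).mul (hS' l).hasFDerivAt
  have hq : HasFDerivAt (fun p => stressFlux S (rigidField a b) p j) _ (x, t) := h
  rw [pdx_eq hq.differentiableAt, hq.fderiv]
  simp only [pdx_eq (hS' _)]
  simp [hde]

theorem sdiv_stressFlux {S : E3 × ℝ → Matrix (Fin 3) (Fin 3) ℝ}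
    (hS : ∀ i j, ContDiff ℝ 1 fun p => S p i j) (a b : E3)
    (hsymm : ∀ i j, S (x, t) i j = S (x, t) j i)
    (hSn : ∀ i, ∑ j, S (x, t) i j * N (x, t) j = 0) :
    sdiv N (stressFlux S (rigidField a b)) x t
      = dot3 (rigidField a b x) (sdivM N S x t) := by
  simp only [sdiv, tder, pdx_stressFlux hS, sdivM, dot3, equiv_symm_coord]
  have s10 := hsymm 1 0
  have s20 := hsymm 2 0
  have s21 := hsymm 2 1
  set P : Fin 3 → Fin 3 → ℝ := fun i j => (if i = j then 1 else 0) - N (x, t) i * N (x, t) j with hP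
  have hsplit : ∀ W : Fin 3 → ℝ, ∀ A : Fin 3 → Fin 3 → Fin 3 → ℝ, ∀ B : Fin 3 → Fin 3 → ℝ,
      ∀ C : Fin 3 → Fin 3 → ℝ,
      ∑ j, ∑ i, P i j * ∑ l, (W l * A i l j + B l j * C i l) =
        ∑ l, W l * ∑ j, ∑ i, P i j * A i l j + ∑ i, ∑ l, C i l * ∑ j, P i j * B l j := by
    intro W A B C
    simp only [Fin.sum_univ_three]
    ring
  have h := hsplit (fun l => rigidField a b x l) (fun i l j => pdx i (fun p => S p l j) x t)
    (S (x, t)) (fun i l => cross3 b (EuclideanSpace.single i 1) l)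
  refine h.trans (add_eq_left.2 ?_)
  have hPS : ∀ i l, ∑ j, P i j * S (x, t) l j = S (x, t) l i := by
    intro i l
    have : ∑ j, P i j * S (x, t) l j
        = S (x, t) l i - N (x, t) i * ∑ j, S (x, t) l j * N (x, t) j := by
      simp only [hP, sub_mul, Finset.sum_sub_distrib, Finset.mul_sum]
      congr 1
      · simp
      · exact Finset.sum_congr rfl fun j _ => by ring
    rw [this, hSn, mul_zero, sub_zero]
  simp only [hPS, Fin.sum_univ_three, cross3_apply_zero, cross3_apply_one, cross3_apply_two]
  simp [s10, s20, s21]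
  ring

end Stress

section StressDivergence

open scoped Topology

variable {U : Set E2} {nU : E2 → E2} {xh : E2 × ℝ → E3} {N : E3 × ℝ → E3} {t : ℝ}

theorem cross3_gVec_eq_areaDensity_smul_of_mem_closure (hxh : ContDiff ℝ 2 xh)
    (hN : ContDiff ℝ 1 N)
    (hframe : ∀ X ∈ U, cross3 (gVec xh 0 X t) (gVec xh 1 X t)
      = areaDensity xh N X t • N (xh (X, t), t)) {X : E2} (hX : X ∈ closure U) :
    cross3 (gVec xh 0 X t) (gVec xh 1 X t) = areaDensity xh N X t • N (xh (X, t), t) := by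
  have hi : Continuous fun Y : E2 => (Y, t) := by fun_prop
  have hNc : Continuous fun Y : E2 => N (xh (Y, t), t) :=
    hN.continuous.comp ((hxh.continuous.comp hi).prodMk continuous_const)
  have h1 : Continuous fun Y => cross3 (gVec xh 0 Y t) (gVec xh 1 Y t) :=
    (contDiff_cross3 (contDiff_gVec hxh 0) (contDiff_gVec hxh 1)).continuous.comp hi
  have h2 : Continuous fun Y => areaDensity xh N Y t :=
    (contDiff_areaDensity hxh hN).continuous.comp hi
  exact closure_minimal (s := U) (t := {Y | _ = _}) hframe (isClosed_eq h1 (h2.smul hNc)) hX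

/-- A stress without co-normal component on the boundary does no total work on rigid motions. -/
theorem integral_areaDensity_mul_sdivM_eq_zero (hU : IsOpen U) (hnU : IsUnitOuterNormal U nU)
    (hxh : ContDiff ℝ 2 xh) (hN : ContDiff ℝ 1 N)
    {S : E3 × ℝ → Matrix (Fin 3) (Fin 3) ℝ} (hS : ∀ i j, ContDiff ℝ 1 fun p => S p i j)
    (hframe : ∀ X ∈ U, cross3 (gVec xh 0 X t) (gVec xh 1 X t)
      = areaDensity xh N X t • N (xh (X, t), t))
    (hn : ∀ X ∈ U, dot3 (N (xh (X, t), t)) (N (xh (X, t), t)) = 1)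
    (hG : ∀ X ∈ closure U, Gdet xh X t ≠ 0)
    (hsymm : ∀ x i j, S (x, t) i j = S (x, t) j i)
    (hSn : ∀ X ∈ U, ∀ i, ∑ j, S (xh (X, t), t) i j * N (xh (X, t), t) j = 0)
    (hbc : ∀ᵐ X ∂((μH[1] : Measure E2).restrict (frontier U)),
      mulVec3 (S (xh (X, t), t)) (conormal xh nU X t) = 0) (a b : E3) :
    ∫ X in U, areaDensity xh N X t
      * dot3 (rigidField a b (xh (X, t))) (sdivM N S (xh (X, t)) t) = 0 := by
  set q := stressFlux S (rigidField a b) with hqdef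
  have hq : ContDiff ℝ 1 q := contDiff_stressFlux hS (contDiff_rigidField a b)
  have hJ : ∀ X ∈ closure U, areaDensity xh N X t ≠ 0 := fun X hX h0 => by
    have h := cross3_gVec_eq_areaDensity_smul_of_mem_closure hxh hN hframe hX
    apply hG X hX
    rw [← norm_cross3_gVec_sq, h, h0]
    simp
  set φ : Fin 2 → E2 → ℝ := fun α X =>
    dot3 (q (xh (X, t), t)) (cross3 (gVec xh α X t) (N (xh (X, t), t))) with hφdef
  have hφ : ∀ α, ContDiff ℝ 1 (φ α) := by
    intro α
    have hi : ContDiff ℝ 1 fun X : E2 => (X, t) := contDiff_id.prodMk contDiff_const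
    have hx : ContDiff ℝ 1 fun X : E2 => (xh (X, t), t) :=
      ((hxh.of_le one_le_two).comp hi).prodMk contDiff_const
    exact contDiff_dot3 (hq.comp hx)
      (contDiff_cross3 ((contDiff_gVec hxh α).comp hi) (hN.comp hx))
  have hdiv := hnU.2 (fun X => !₂[φ 1 X, -φ 0 X]) (contDiff_euclidean.2 fun i => by
    fin_cases i
    · exact hφ 1
    · exact (hφ 0).neg)
  have hR : ∫ X in frontier U, dot2 (!₂[φ 1 X, -φ 0 X]) (nU X) ∂(μH[1] : Measure E2) = 0 := by
    refine integral_eq_zero_of_ae ?_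
    filter_upwards [hbc, ae_restrict_mem isClosed_frontier.measurableSet] with X hX hXU
    have hXc := frontier_subset_closure hXU
    have hf := cross3_gVec_eq_areaDensity_smul_of_mem_closure hxh hN hframe hXc
    set u := nU X 0 • gVec xh 1 X t - nU X 1 • gVec xh 0 X t with hu
    have h1 : dot2 (!₂[φ 1 X, -φ 0 X]) (nU X)
        = dot3 (q (xh (X, t), t)) (cross3 u (N (xh (X, t), t))) := by
      simp only [dot2, Fin.sum_univ_two, hφdef, hu, dot3_eq, cross3_apply_zero, cross3_apply_one,
        cross3_apply_two]
      simp
      ring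
    have h2 : ∃ c : ℝ, cross3 u (N (xh (X, t), t)) = c • conormal xh nU X t := by
      have hm : ‖cross3 (gVec xh 0 X t) (gVec xh 1 X t)‖ ≠ 0 := fun h => by
        apply hG X hXc
        rw [← norm_cross3_gVec_sq, h]
        simp
      by_cases hu0 : u = 0
      · refine ⟨0, ?_⟩
        rw [hu0]
        ext i
        fin_cases i <;> simp
      · have hu1 : ‖u‖ ≠ 0 := norm_ne_zero_iff.2 hu0
        refine ⟨‖u‖ * ‖cross3 (gVec xh 0 X t) (gVec xh 1 X t)‖ * (areaDensity xh N X t)⁻¹, ?_⟩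
        have hJX := hJ X hXc
        rw [conormal, ← hu, nHat]
        nth_rw 3 [hf]
        ext i
        fin_cases i <;> simp <;> field_simp
    obtain ⟨c, hc⟩ := h2
    change dot2 (!₂[φ 1 X, -φ 0 X]) (nU X) = 0
    rw [h1, hc, dot3_eq_inner, real_inner_smul_right, ← dot3_eq_inner, hqdef, dot3_stressFlux, hX]
    simp [dot3]
  rw [hR] at hdiv
  rw [← hdiv]
  refine setIntegral_congr_fun hU.measurableSet fun X hX => ?_
  have hUX : U ∈ 𝓝 X := hU.mem_nhds hX
  have hqN : dot3 (q (xh (X, t), t)) (N (xh (X, t), t)) = 0 := by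
    rw [hqdef, dot3_stressFlux]
    have : mulVec3 (S (xh (X, t), t)) (N (xh (X, t), t)) = 0 := by
      ext i
      exact hSn X hX i
    rw [this]
    simp [dot3]
  have h := fderiv_pullback_eq_sdiv hxh hN hq (hJ X (subset_closure hX))
    (Filter.eventually_of_mem hUX hn) (hframe X hX) hqN
  rw [hqdef, sdiv_stressFlux hS a b (hsymm _) (hSn X hX)] at h
  beta_reduce
  rw [← h, Fin.sum_univ_two]
  change _ = fderiv ℝ (φ 1) X _ + fderiv ℝ (fun Y => -φ 0 Y) X _
  rw [fderiv_fun_neg]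
  rfl

end StressDivergence

section Transport

open scoped Topology

variable {U : Set E2}

theorem Continuous.integrableOn_of_isBounded {G : Type*} [NormedAddCommGroup G] {f : E2 → G}
    (hf : Continuous f) (hU : Bornology.IsBounded U) : IntegrableOn f U :=
  (hf.continuousOn.integrableOn_compact hU.isCompact_closure).mono_set subset_closure

theorem Continuous.integrable_prod_of_isBounded {G : Type*} [NormedAddCommGroup G]
    {f : E2 × ℝ → G} (hf : Continuous f) (hU : Bornology.IsBounded U) (t₁ t₂ : ℝ) :
    Integrable f (((volume : Measure E2).restrict U).prod
      ((volume : Measure ℝ).restrict (Set.Ioc t₁ t₂))) := by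
  rw [Measure.prod_restrict]
  exact (hf.continuousOn.integrableOn_compact (hU.isCompact_closure.prod
    (isCompact_Icc (a := t₁) (b := t₂)))).mono_set
    (Set.prod_mono subset_closure Set.Ioc_subset_Icc_self)

theorem Continuous.intervalIntegrable_setIntegral {G : Type*} [NormedAddCommGroup G]
    [NormedSpace ℝ G] {f : E2 × ℝ → G} (hf : Continuous f) (hU : Bornology.IsBounded U)
    {t₁ t₂ : ℝ} (h : t₁ ≤ t₂) :
    IntervalIntegrable (fun τ => ∫ X in U, f (X, τ)) volume t₁ t₂ :=
  (intervalIntegrable_iff_integrableOn_Ioc_of_le h).2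
    (hf.integrable_prod_of_isBounded hU t₁ t₂).integral_prod_right

theorem setIntegral_eq_add_integral_fderiv {h : E2 × ℝ → ℝ} (hh : ContDiff ℝ 1 h)
    (hU : Bornology.IsBounded U) {t₁ t₂ : ℝ} (ht : t₁ ≤ t₂) :
    ∫ X in U, h (X, t₂) = (∫ X in U, h (X, t₁))
      + ∫ τ in t₁..t₂, ∫ X in U, fderiv ℝ h (X, τ) (0, 1) := by
  have hk : Continuous fun p => fderiv ℝ h p (0, 1) :=
    (hh.continuous_fderiv one_ne_zero).clm_apply continuous_const
  have hi : ∀ t, IntegrableOn (fun X => h (X, t)) U := fun t =>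
    (hh.continuous.comp (by fun_prop : Continuous fun X : E2 => (X, t))).integrableOn_of_isBounded
      hU
  rw [intervalIntegral.integral_of_le ht,
    ← integral_integral_swap (hk.integrable_prod_of_isBounded hU t₁ t₂),
    ← sub_eq_iff_eq_add', ← integral_sub (hi t₂) (hi t₁)]
  refine integral_congr_ae (ae_of_all _ fun X => ?_)
  beta_reduce
  rw [← intervalIntegral.integral_of_le ht]
  have hd : ∀ τ, HasDerivAt (fun s => h (X, s)) (fderiv ℝ h (X, τ) (0, 1)) τ := fun τ =>
    (hh.differentiable one_ne_zero (X, τ)).hasFDerivAt.slice_right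
  exact (intervalIntegral.integral_eq_sub_of_hasDerivAt (fun τ _ => hd τ)
    ((hk.comp (by fun_prop : Continuous fun τ : ℝ => (X, τ))).intervalIntegrable _ _)).symm

theorem contDiff_momentum {v : E3 × ℝ → E3} {ρ : E3 × ℝ → ℝ} (hv : ContDiff ℝ 1 v)
    (hρ : ContDiff ℝ 1 ρ) (a b : E3) :
    ContDiff ℝ 1 fun p : E3 × ℝ => ρ p * dot3 (v p) (rigidField a b p.1) :=
  hρ.mul (contDiff_dot3 hv ((contDiff_rigidField a b).comp contDiff_fst))

/-- The material derivative of the momentum density in the direction of a rigid motion. -/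
theorem fderiv_momentum {v : E3 × ℝ → E3} {ρ : E3 × ℝ → ℝ} (hv : ContDiff ℝ 1 v)
    (hρ : ContDiff ℝ 1 ρ) (a b x : E3) (t : ℝ) :
    fderiv ℝ (fun p : E3 × ℝ => ρ p * dot3 (v p) (rigidField a b p.1)) (x, t) (v (x, t), 1)
      = Dt v ρ x t * dot3 (v (x, t)) (rigidField a b x)
        + ρ (x, t) * ∑ i, Dt v (fun p => v p i) x t * rigidField a b x i := by
  have hv' := (hv.differentiable one_ne_zero (x, t))
  have hρ' := (hρ.differentiable one_ne_zero (x, t))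
  obtain ⟨w', hw', hwe⟩ := hasFDerivAt_rigidField a b (x, t)
  obtain ⟨d, hd, hde⟩ := hasFDerivAt_dot3 hv'.hasFDerivAt hw'
  have h0 : dot3 (v (x, t)) (cross3 b (v (x, t))) = 0 := by
    simp only [dot3_eq, cross3_apply_zero, cross3_apply_one, cross3_apply_two]
    ring
  have h1 : ∀ i, Dt v (fun p => v p i) x t = fderiv ℝ v (x, t) (v (x, t), 1) i := fun i => by
    rw [fderiv_apply_component hv', fderiv_apply_material]
    exact (hasFDerivAt_apply_comp hv'.hasFDerivAt i).differentiableAt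
  rw [(hρ'.hasFDerivAt.fun_mul hd).fderiv, ← fderiv_apply_material hρ']
  simp only [add_apply, smul_apply, hde, hwe, h0, h1, smul_eq_mul]
  simp only [dot3]
  ring

variable {xh : E2 × ℝ → E3} {N v F : E3 × ℝ → E3} {ρ : E3 × ℝ → ℝ}
  {S : E3 × ℝ → Matrix (Fin 3) (Fin 3) ℝ} {X : E2} {t : ℝ}

theorem fderiv_areaDensity_mul_momentum (hxh : ContDiff ℝ 2 xh) (hN : ContDiff ℝ 1 N)
    (hv : ContDiff ℝ 2 v) (hρ : ContDiff ℝ 1 ρ)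
    (hn : ∀ᶠ s in 𝓝 t, dot3 (N (xh (X, s), s)) (N (xh (X, s), s)) = 1)
    (hframe : cross3 (gVec xh 0 X t) (gVec xh 1 X t) = areaDensity xh N X t • N (xh (X, t), t))
    (hflow : ∀ᶠ Y in 𝓝 X, deriv (fun s => xh (Y, s)) t = v (xh (Y, t), t))
    (hcont : Dt v ρ (xh (X, t)) t + sdiv N v (xh (X, t)) t * ρ (xh (X, t), t) = 0)
    (hmom : ∀ i, ρ (xh (X, t), t) * Dt v (fun p => v p i) (xh (X, t)) t
      = sdivM N S (xh (X, t)) t i + ρ (xh (X, t), t) * F (xh (X, t), t) i) (a b : E3) :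
    fderiv ℝ (fun p : E2 × ℝ => areaDensity xh N p.1 p.2
        * (ρ (xh p, p.2) * dot3 (v (xh p, p.2)) (rigidField a b (xh p)))) (X, t) (0, 1)
      = areaDensity xh N X t * dot3 (rigidField a b (xh (X, t))) (sdivM N S (xh (X, t)) t)
        + areaDensity xh N X t
          * (ρ (xh (X, t), t) * dot3 (F (xh (X, t), t)) (rigidField a b (xh (X, t)))) := by
  have hm := contDiff_momentum (hv.of_le one_le_two) hρ a b
  have hx : ContDiff ℝ 1 fun p : E2 × ℝ => (xh p, p.2) :=
    (hxh.of_le one_le_two).prodMk contDiff_snd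
  have hd := ((contDiff_areaDensity hxh hN).mul (hm.comp hx)).differentiable one_ne_zero (X, t)
  have h1 := hd.hasFDerivAt.slice_right
  have h2 := (hasDerivAt_areaDensity hxh hN hv hn hframe hflow).mul
    (hasDerivAt_comp_surface (hm.differentiable one_ne_zero) hxh hflow.self_of_nhds)
  have h3 := h1.unique h2
  refine Eq.trans h3 ?_
  rw [fderiv_momentum (hv.of_le one_le_two) hρ]
  simp only [dot3_eq, Fin.sum_univ_three]
  have m0 := hmom 0
  have m1 := hmom 1
  have m2 := hmom 2
  set W := rigidField a b (xh (X, t))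
  linear_combination areaDensity xh N X t * (v (xh (X, t), t) 0 * W 0 + v (xh (X, t), t) 1 * W 1
    + v (xh (X, t), t) 2 * W 2) * hcont + areaDensity xh N X t * (W 0 * m0 + W 1 * m1 + W 2 * m2)

end Transport

section Area

variable {xh : E2 × ℝ → E3} {t : ℝ}

theorem normDet_fderiv_sq (X : E2) :
    (fderiv ℝ (fun Y => xh (Y, t)) X : E2 →ₗ[ℝ] E3).normDet ^ 2 = Gdet xh X t := by
  have h := LinearMap.normDet_sq_eq_det_gram (fderiv ℝ (fun Y => xh (Y, t)) X : E2 →ₗ[ℝ] E3)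
    (EuclideanSpace.basisFun (Fin 2) ℝ)
  rw [Matrix.det_fin_two] at h
  simp only [Gdet, gMet, gVec, dot3_eq_inner]
  simpa [Matrix.gram] using h

theorem exists_integral_image_eq_areaDensity : ∃ c : ℝ, ∀ {U : Set E2} {xh : E2 × ℝ → E3}
    {N : E3 × ℝ → E3} {t : ℝ}, IsOpen U → ContDiff ℝ 2 xh → ContDiff ℝ 1 N →
    (∀ X ∈ U, areaDensity xh N X t = ‖cross3 (gVec xh 0 X t) (gVec xh 1 X t)‖) →
    (∀ X ∈ U, Gdet xh X t ≠ 0) → Set.InjOn (fun X => xh (X, t)) U →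
    ∀ g : E3 → E3, Continuous g →
      ∫ x in (fun X => xh (X, t)) '' U, g x ∂(μH[2] : Measure E3)
        = c • ∫ X in U, areaDensity xh N X t • g (xh (X, t)) := by
  have hfr : ((Module.finrank ℝ E2 : ℕ) : ℝ) = 2 := by simp
  obtain ⟨c, hc⟩ : ∃ c : NNReal,
      (μH[(Module.finrank ℝ E2 : ℕ)] : Measure E2) = c • (volume : Measure E2) :=
    ⟨_, Measure.isAddLeftInvariant_eq_smul (μH[(Module.finrank ℝ E2 : ℕ)] : Measure E2) volume⟩
  refine ⟨c, ?_⟩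
  intro U xh N t hU hxh hN hJ hG hinj g hg
  have hi : ContDiff ℝ 2 fun X : E2 => (X, t) := contDiff_id.prodMk contDiff_const
  have hx : ContDiff ℝ 2 fun X => xh (X, t) := hxh.comp hi
  have hn : ∀ X ∈ U, areaDensity xh N X t
      = (fderiv ℝ (fun Y => xh (Y, t)) X : E2 →ₗ[ℝ] E3).normDet := fun X hX => by
    rw [hJ X hX, ← sq_eq_sq₀ (norm_nonneg _) (LinearMap.normDet_nonneg _), norm_cross3_gVec_sq,
      normDet_fderiv_sq]
  have hpos : ∀ X ∈ U, 0 < areaDensity xh N X t := fun X hX => by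
    rw [hJ X hX, norm_pos_iff, ← norm_ne_zero_iff, ← pow_ne_zero_iff two_ne_zero, norm_cross3_gVec_sq]
    exact hG X hX
  have h := integral_image_hausdorffMeasure hU
    (fun X _ => hx.contDiffAt.hasStrictFDerivAt two_ne_zero)
    (fun X hX => LinearMap.ker_eq_bot.1 (not_not.1
      (LinearMap.normDet_eq_zero_iff_ker_ne_bot.not.1 ((hn X hX).symm.trans_ne (hpos X hX).ne'))))
    hinj ((contDiff_areaDensity hxh hN).continuous.comp hi.continuous).continuousOn hn hpos hg
  rw [hfr] at h hc
  rw [h, hc, Measure.restrict_smul, integral_smul_nnreal_measure]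
  rfl

end Area

section Balance

variable {U : Set E2} {nU : E2 → E2} {T : ℝ} {xh : E2 × ℝ → E3} {N v F : E3 × ℝ → E3}
  {ρ : E3 × ℝ → ℝ} {S : E3 × ℝ → Matrix (Fin 3) (Fin 3) ℝ}

/-- The balance law for the momentum in the direction of an infinitesimal rigid motion, in the
reference coordinates. -/
theorem setIntegral_momentum_balance (hU : IsOpen U) (hUbd : Bornology.IsBounded U)
    (hnU : IsUnitOuterNormal U nU) (hxh : ContDiff ℝ 2 xh) (hN : ContDiff ℝ 1 N)
    (hv : ContDiff ℝ 2 v) (hρ : ContDiff ℝ 1 ρ) (hF : Continuous F)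
    (hS : ∀ i j, ContDiff ℝ 1 fun p => S p i j)
    (hframe : ∀ t ∈ Set.Ioo 0 T, ∀ X ∈ U, cross3 (gVec xh 0 X t) (gVec xh 1 X t)
      = areaDensity xh N X t • N (xh (X, t), t))
    (hn : ∀ t ∈ Set.Ioo 0 T, ∀ X ∈ U, dot3 (N (xh (X, t), t)) (N (xh (X, t), t)) = 1)
    (hG : ∀ t ∈ Set.Ioo 0 T, ∀ X ∈ closure U, Gdet xh X t ≠ 0)
    (hflow : ∀ t ∈ Set.Ioo 0 T, ∀ X ∈ U, deriv (fun s => xh (X, s)) t = v (xh (X, t), t))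
    (hcont : ∀ t ∈ Set.Ioo 0 T, ∀ X ∈ U,
      Dt v ρ (xh (X, t)) t + sdiv N v (xh (X, t)) t * ρ (xh (X, t), t) = 0)
    (hmom : ∀ t ∈ Set.Ioo 0 T, ∀ X ∈ U, ∀ i,
      ρ (xh (X, t), t) * Dt v (fun p => v p i) (xh (X, t)) t
        = sdivM N S (xh (X, t)) t i + ρ (xh (X, t), t) * F (xh (X, t), t) i)
    (hsymm : ∀ p i j, S p i j = S p j i)
    (hSn : ∀ t ∈ Set.Ioo 0 T, ∀ X ∈ U, ∀ i,
      ∑ j, S (xh (X, t), t) i j * N (xh (X, t), t) j = 0)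
    (hbc : ∀ t ∈ Set.Ioo 0 T, ∀ᵐ X ∂((μH[1] : Measure E2).restrict (frontier U)),
      mulVec3 (S (xh (X, t), t)) (conormal xh nU X t) = 0)
    (a b : E3) {t₁ t₂ : ℝ} (h₁ : 0 < t₁) (h₁₂ : t₁ < t₂) (h₂ : t₂ < T) :
    ∫ X in U, areaDensity xh N X t₂
        * (ρ (xh (X, t₂), t₂) * dot3 (v (xh (X, t₂), t₂)) (rigidField a b (xh (X, t₂))))
      = (∫ X in U, areaDensity xh N X t₁
          * (ρ (xh (X, t₁), t₁) * dot3 (v (xh (X, t₁), t₁)) (rigidField a b (xh (X, t₁)))))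
        + ∫ τ in t₁..t₂, ∫ X in U, areaDensity xh N X τ
          * (ρ (xh (X, τ), τ) * dot3 (F (xh (X, τ), τ)) (rigidField a b (xh (X, τ)))) := by
  have hJ := contDiff_areaDensity hxh hN
  have hx : ContDiff ℝ 1 fun p : E2 × ℝ => (xh p, p.2) :=
    (hxh.of_le one_le_two).prodMk contDiff_snd
  have hh := hJ.mul ((contDiff_momentum (hv.of_le one_le_two) hρ a b).comp hx)
  have hbal := setIntegral_eq_add_integral_fderiv hh hUbd h₁₂.le
  refine hbal.trans ?_
  congr 1
  refine intervalIntegral.integral_congr fun τ hτ => ?_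
  rw [Set.uIcc_of_le h₁₂.le] at hτ
  have hτT : τ ∈ Set.Ioo 0 T := ⟨h₁.trans_le hτ.1, hτ.2.trans_lt h₂⟩
  have hi : Continuous fun X : E2 => (X, τ) := by fun_prop
  have hk : Continuous fun p : E2 × ℝ => areaDensity xh N p.1 p.2
      * (ρ (xh p, p.2) * dot3 (F (xh p, p.2)) (rigidField a b (xh p))) := by
    have hw := (contDiff_rigidField a b (n := 0)).continuous.comp hxh.continuous
    simp only [dot3_eq_inner]
    exact hJ.continuous.mul ((hρ.continuous.comp hx.continuous).mul
      ((hF.comp hx.continuous).inner hw))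
  have hI1 := (((hh.continuous_fderiv one_ne_zero).clm_apply
    (continuous_const (y := ((0 : E2), (1 : ℝ))))).comp hi).integrableOn_of_isBounded hUbd
  have hI2 := (hk.comp hi).integrableOn_of_isBounded hUbd
  refine sub_eq_zero.1 ((integral_sub hI1 hI2).symm.trans ?_)
  rw [← integral_areaDensity_mul_sdivM_eq_zero hU hnU hxh hN hS (hframe τ hτT) (hn τ hτT)
    (hG τ hτT) (fun _ => hsymm _) (hSn τ hτT) (hbc τ hτT) a b]
  refine setIntegral_congr_fun hU.measurableSet fun X hX => sub_eq_iff_eq_add.2 ?_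
  exact fderiv_areaDensity_mul_momentum hxh hN hv hρ
    (Filter.eventually_of_mem (isOpen_Ioo.mem_nhds hτT) fun s hs => hn s hs X hX)
    (hframe τ hτT X hX)
    (Filter.eventually_of_mem (hU.mem_nhds hX) (hflow τ hτT))
    (hcont τ hτT X hX) (hmom τ hτT X hX) a b

theorem setIntegral_eq_add_of_components {f g : E2 × ℝ → E3} (hf : Continuous f)
    (hg : Continuous g) (hUbd : Bornology.IsBounded U) {t₁ t₂ : ℝ} (h : t₁ ≤ t₂)
    (hi : ∀ i, ∫ X in U, f (X, t₂) i
      = (∫ X in U, f (X, t₁) i) + ∫ τ in t₁..t₂, ∫ X in U, g (X, τ) i) :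
    ∫ X in U, f (X, t₂) = (∫ X in U, f (X, t₁)) + ∫ τ in t₁..t₂, ∫ X in U, g (X, τ) := by
  have hs : ∀ {k : E2 × ℝ → E3}, Continuous k → ∀ t i,
      (∫ X in U, k (X, t)) i = ∫ X in U, k (X, t) i := fun hk t i =>
    ((EuclideanSpace.proj i : E3 →L[ℝ] ℝ).integral_comp_comm
      ((hk.comp (by fun_prop : Continuous fun X : E2 => (X, t))).integrableOn_of_isBounded
        hUbd)).symm
  ext i
  have h3 : (∫ τ in t₁..t₂, ∫ X in U, g (X, τ)) i = ∫ τ in t₁..t₂, ∫ X in U, g (X, τ) i := by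
    simp only [← hs hg]
    exact ((EuclideanSpace.proj i : E3 →L[ℝ] ℝ).intervalIntegral_comp_comm
      (hg.intervalIntegrable_setIntegral hUbd h)).symm
  rw [PiLp.add_apply, hs hf, hs hf, h3, hi]

theorem continuous_cross3 {A : Type*} [TopologicalSpace A] {b c : A → E3} (hb : Continuous b)
    (hc : Continuous c) : Continuous fun Y => cross3 (b Y) (c Y) :=
  (contDiff_cross3 (n := 0) contDiff_fst contDiff_snd).continuous.comp (hb.prodMk hc)

theorem dot3_rigidField_single_zero (u x : E3) (i : Fin 3) :
    dot3 u (rigidField (EuclideanSpace.single i 1) 0 x) = u i := by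
  fin_cases i <;> simp [dot3_eq, rigidField]

theorem dot3_rigidField_zero_single (u x : E3) (i : Fin 3) :
    dot3 u (rigidField 0 (EuclideanSpace.single i 1) x) = cross3 x u i := by
  fin_cases i <;> simp [dot3_eq, rigidField] <;> ring

theorem cross3_smul (x u : E3) (r : ℝ) : cross3 x (r • u) = r • cross3 x u := by
  ext i
  fin_cases i <;> simp <;> ring

end Balance

/-- conservation of momentum and of angular momentum for the generalized
compressible fluid system under the zero co-normal stress boundary condition. -/
theorem conservation_of_momentum_and_angular_momentum
    (T : ℝ) (hT : 0 < T)
    (U : Set E2) (hUopen : IsOpen U) (hUconn : IsConnected U) (hUbd : Bornology.IsBounded U)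
    (nU : E2 → E2) (hnU : IsUnitOuterNormal U nU)
    (xh : E2 × ℝ → E3) (hxh : ContDiff ℝ 2 xh)
    (lam : ℝ) (hlam : 0 < lam)
    (hG : ∀ X ∈ closure U, ∀ t ∈ Set.Ico (0 : ℝ) T, lam ≤ Gdet xh X t)
    (hinj : ∀ t ∈ Set.Ico (0 : ℝ) T, Set.InjOn (fun X => xh (X, t)) (closure U))
    (Γ : ℝ → Set E3) (hΓ : ∀ t, Γ t = (fun X => xh (X, t)) '' U)
    (bΓ : ℝ → Set E3) (hbΓ : ∀ t, bΓ t = (fun X => xh (X, t)) '' frontier U)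
    (N : E3 × ℝ → E3) (hN : ContDiff ℝ 1 N)
    (hNs : ∀ X ∈ U, ∀ t ∈ Set.Ico (0 : ℝ) T, N (xh (X, t), t) = nHat xh X t)
    (hNnorm : ∀ t ∈ Set.Ico (0 : ℝ) T, ∀ x ∈ Γ t ∪ bΓ t, ‖N (x, t)‖ = 1)
    (v : E3 × ℝ → E3) (hv : ContDiff ℝ 2 v)
    (hflow : ∀ X ∈ U, ∀ t ∈ Set.Ico (0 : ℝ) T,
      deriv (fun s => xh (X, s)) t = v (xh (X, t), t))
    (ρ σ : E3 × ℝ → ℝ) (hρ : ContDiff ℝ 2 ρ) (hσ : ContDiff ℝ 2 σ)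
    (F : E3 × ℝ → E3) (hF : ContDiff ℝ 2 F)
    (e₁ e₂ : ℝ → ℝ) (he₁ : ContDiff ℝ 2 e₁) (he₂ : ContDiff ℝ 2 e₂)
    -- the continuity equation on Γ_T
    (hcont : ∀ t ∈ Set.Ioo (0 : ℝ) T, ∀ x ∈ Γ t,
      Dt v ρ x t + sdiv N v x t * ρ (x, t) = 0)
    -- the momentum equation on Γ_T
    (hmom : ∀ t ∈ Set.Ioo (0 : ℝ) T, ∀ x ∈ Γ t, ∀ i : Fin 3,
      ρ (x, t) * Dt v (fun p => v p i) x t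
        = sdivM N (fun p => SGam N v σ e₁ e₂ p.1 p.2) x t i + ρ (x, t) * F (x, t) i)
    -- zero co-normal stress on the boundary
    (hbc : ∀ t ∈ Set.Ioo (0 : ℝ) T,
      ∀ᵐ X ∂((μH[1] : Measure E2).restrict (frontier U)),
        mulVec3 (SGam N v σ e₁ e₂ (xh (X, t)) t) (conormal xh nU X t) = 0) :
    ∀ t₁ t₂ : ℝ, 0 < t₁ → t₁ < t₂ → t₂ < T →
      ((∫ x in Γ t₂, ρ (x, t₂) • v (x, t₂) ∂(μH[2] : Measure E3))
          = (∫ x in Γ t₁, ρ (x, t₁) • v (x, t₁) ∂(μH[2] : Measure E3))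
            + ∫ τ in t₁..t₂, ∫ x in Γ τ, ρ (x, τ) • F (x, τ) ∂(μH[2] : Measure E3)) ∧
      ((∫ x in Γ t₂, cross3 x (ρ (x, t₂) • v (x, t₂)) ∂(μH[2] : Measure E3))
          = (∫ x in Γ t₁, cross3 x (ρ (x, t₁) • v (x, t₁)) ∂(μH[2] : Measure E3))
            + ∫ τ in t₁..t₂, ∫ x in Γ τ,
                cross3 x (ρ (x, τ) • F (x, τ)) ∂(μH[2] : Measure E3)) := by
  intro t₁ t₂ h₁ h₁₂ h₂
  have hIco : ∀ t ∈ Set.Ioo 0 T, t ∈ Set.Ico 0 T := fun t ht => ⟨ht.1.le, ht.2⟩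
  have hΓmem : ∀ t, ∀ X ∈ U, xh (X, t) ∈ Γ t := fun t X hX => by
    rw [hΓ]
    exact Set.mem_image_of_mem _ hX
  have hn1 : ∀ t ∈ Set.Ico 0 T, ∀ X ∈ U, ‖N (xh (X, t), t)‖ = 1 := fun t ht X hX =>
    hNnorm t ht _ (Or.inl (hΓmem t X hX))
  have hG0 : ∀ t ∈ Set.Ico 0 T, ∀ X ∈ closure U, Gdet xh X t ≠ 0 := fun t ht X hX =>
    (hlam.trans_le (hG X hX t ht)).ne'
  have hdot : ∀ t ∈ Set.Ioo 0 T, ∀ X ∈ U, dot3 (N (xh (X, t), t)) (N (xh (X, t), t)) = 1 :=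
    fun t ht X hX => by rw [dot3_self, hn1 t (hIco t ht) X hX, one_pow]
  have hbal := fun a b => setIntegral_momentum_balance hUopen hUbd hnU hxh hN hv
    (hρ.of_le one_le_two) hF.continuous (contDiff_SGam hN hv hσ he₁ he₂)
    (fun t ht X hX => cross3_gVec_eq_areaDensity_smul (hNs X hX t (hIco t ht))
      (hn1 t (hIco t ht) X hX)) hdot (fun t ht => hG0 t (hIco t ht))
    (fun t ht X hX => hflow X hX t (hIco t ht)) (fun t ht X hX => hcont t ht _ (hΓmem t X hX))
    (fun t ht X hX => hmom t ht _ (hΓmem t X hX)) (fun _ => SGam_symm)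
    (fun t ht X hX => SGam_mulVec_normal (hdot t ht X hX)) hbc a b h₁ h₁₂ h₂
  obtain ⟨c, hc⟩ := exists_integral_image_eq_areaDensity
  have harea : ∀ t ∈ Set.Icc t₁ t₂, ∀ g : E3 → E3, Continuous g →
      ∫ x in Γ t, g x ∂(μH[2] : Measure E3)
        = c • ∫ X in U, areaDensity xh N X t • g (xh (X, t)) := by
    intro t ht g hg
    have htT : t ∈ Set.Ico 0 T := ⟨h₁.le.trans ht.1, ht.2.trans_lt h₂⟩
    rw [hΓ]
    exact hc hUopen hxh hN
      (fun X hX => areaDensity_eq_norm (hNs X hX t htT) (hn1 t htT X hX))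
      (fun X hX => hG0 t htT X (subset_closure hX)) ((hinj t htT).mono subset_closure) g hg
  have hJ := (contDiff_areaDensity hxh hN).continuous
  have hx : Continuous fun p : E2 × ℝ => (xh p, p.2) := hxh.continuous.prodMk continuous_snd
  have key : ∀ f g : E3 × ℝ → E3, Continuous f → Continuous g →
      (∀ i, ∃ a b : E3, (∀ p, f p i = ρ p * dot3 (v p) (rigidField a b p.1)) ∧
        ∀ p, g p i = ρ p * dot3 (F p) (rigidField a b p.1)) →
      ∫ x in Γ t₂, f (x, t₂) ∂(μH[2] : Measure E3)
        = (∫ x in Γ t₁, f (x, t₁) ∂(μH[2] : Measure E3))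
          + ∫ τ in t₁..t₂, ∫ x in Γ τ, g (x, τ) ∂(μH[2] : Measure E3) := by
    intro f g hf hg hfg
    have hsl : ∀ t : ℝ, Continuous fun x : E3 => (x, t) := fun t => by fun_prop
    have h3 : ∫ τ in t₁..t₂, ∫ x in Γ τ, g (x, τ) ∂(μH[2] : Measure E3)
        = c • ∫ τ in t₁..t₂, ∫ X in U, areaDensity xh N X τ • g (xh (X, τ), τ) := by
      rw [← intervalIntegral.integral_smul]
      refine intervalIntegral.integral_congr fun τ hτ => ?_
      rw [Set.uIcc_of_le h₁₂.le] at hτ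
      exact harea τ hτ _ (hg.comp (hsl τ))
    rw [harea t₂ (Set.right_mem_Icc.2 h₁₂.le) (fun x => f (x, t₂)) (hf.comp (hsl t₂)),
      harea t₁ (Set.left_mem_Icc.2 h₁₂.le) (fun x => f (x, t₁)) (hf.comp (hsl t₁)), h3, ← smul_add]
    congr 1
    refine setIntegral_eq_add_of_components
      (f := fun p => areaDensity xh N p.1 p.2 • f (xh p, p.2))
      (g := fun p => areaDensity xh N p.1 p.2 • g (xh p, p.2))
      (hJ.smul (hf.comp hx)) (hJ.smul (hg.comp hx)) hUbd h₁₂.le fun i => ?_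
    obtain ⟨a, b, hfi, hgi⟩ := hfg i
    simp only [PiLp.smul_apply, smul_eq_mul, hfi, hgi]
    exact hbal a b
  have hρv : Continuous fun p => ρ p • v p := hρ.continuous.smul hv.continuous
  have hρF : Continuous fun p => ρ p • F p := hρ.continuous.smul hF.continuous
  refine ⟨key _ _ hρv hρF fun i => ⟨EuclideanSpace.single i 1, 0, fun p => ?_, fun p => ?_⟩,
    key (fun p => cross3 p.1 (ρ p • v p)) (fun p => cross3 p.1 (ρ p • F p))
      (continuous_cross3 continuous_fst hρv) (continuous_cross3 continuous_fst hρF)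
      fun i => ⟨0, EuclideanSpace.single i 1, fun p => ?_, fun p => ?_⟩⟩
  · rw [dot3_rigidField_single_zero, PiLp.smul_apply, smul_eq_mul]
  · rw [dot3_rigidField_single_zero, PiLp.smul_apply, smul_eq_mul]
  · rw [dot3_rigidField_zero_single, cross3_smul, PiLp.smul_apply, smul_eq_mul]
  · rw [dot3_rigidField_zero_single, cross3_smul, PiLp.smul_apply, smul_eq_mul]
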